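/- Let U be a left bialgebroid over A and P_n := U^{⊗_{A^{op}}(n+1)} the bar resolution with differential b'(u⁰,…,uⁿ) = Σ_{i=0}^{n−1}(−1)^i(u⁰,…,u^iu^{i+1},…,uⁿ) + (−1)^n(u⁰,…,u^{n−2}, ε(uⁿ)▸u^{n−1}). Define Δ^P : P → P ⊗_A P by Δ^P(u⁰,…,uⁿ) := Σ_{i=0}^n (u⁰_{(1)},…,u^i_{(1)}) ⊗_A (u⁰_{(2)}⋯u^i_{(2)}, u^{i+1},…,uⁿ) and ε^P := ε on P_0 = U, ε^P := 0 in positive degrees. Then Δ^P is coassociative and (P, b', Δ^P, ε^P) is a differential graded coalgebra: the counit property holds and Δ^P b' = (b' ⊗ id_P + id_P ⊗ b')Δ^P with Koszul signs. -/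

import Mathlib

open Function TensorProduct

noncomputable section

universe u v w

/-- Transport an element of a type family along an equality of indices. -/
def dcast {ι : Sort w} {F : ι → Sort v} {a b : ι} (x : F a) (h : a = b) : F b := h ▸ x

/-- Transport as a linear equivalence. -/
def dEquiv (k : Type u) [CommRing k] {ι : Type w} (F : ι → Type v)
    [∀ i, AddCommGroup (F i)] [∀ i, Module k (F i)] {a b : ι} (h : a = b) :
    F a ≃ₗ[k] F b := by subst h; exact LinearEquiv.refl k (F a)

/-- A Gerstenhaber algebra over `k` on an `ℕ`-graded family `V`. -/
structure GerstenhaberAlgebra (k : Type u) [CommRing k] (V : ℕ → Type v)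
    [∀ p, AddCommGroup (V p)] [∀ p, Module k (V p)] where
  one : V 0
  mul : ∀ {p q : ℕ}, V p →ₗ[k] V q →ₗ[k] V (p + q)
  /-- The (extended) Gerstenhaber bracket `{·,·} : V^{p+1} ⊗ V^q → V^{p+q}`. -/
  bracket : ∀ {p q : ℕ}, V (p + 1) →ₗ[k] V q →ₗ[k] V (p + q)
  mul_assoc : ∀ {p q r : ℕ} (a : V p) (b : V q) (c : V r),
      mul a (mul b c) = dcast (F := V) (mul (mul a b) c) (by omega)
  one_mul : ∀ {p : ℕ} (a : V p), a = dcast (F := V) (mul one a) (by omega)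
  mul_one : ∀ {p : ℕ} (a : V p), mul a one = a
  mul_comm : ∀ {p q : ℕ} (a : V p) (b : V q),
      ((-1 : ℤ) ^ (p * q)) • mul a b = dcast (F := V) (mul b a) (by omega)
  bracket_antisymm : ∀ {p q : ℕ} (a : V (p + 1)) (b : V (q + 1)),
      bracket a b = -(((-1 : ℤ) ^ (p * q)) • dcast (F := V) (bracket b a) (by omega))
  bracket_jacobi : ∀ {p q r : ℕ} (a : V (p + 1)) (b : V (q + 1)) (c : V r),
      bracket a (bracket b c)
        = dcast (F := V) (bracket (p := p + q) (bracket a b) c) (by omega)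
          + ((-1 : ℤ) ^ (p * q)) • dcast (F := V) (bracket b (bracket a c)) (by omega)
  leibniz : ∀ {p q r : ℕ} (γ : V (p + 1)) (a : V q) (b : V r),
      bracket γ (mul a b)
        = dcast (F := V) (mul (bracket γ a) b) (by omega)
          + ((-1 : ℤ) ^ (p * q)) • dcast (F := V) (mul a (bracket γ b)) (by omega)

/-- A Gerstenhaber module over a Gerstenhaber algebra, on a `ℤ`-graded family `Ω`. -/
structure GerstenhaberModule (k : Type u) [CommRing k] (V : ℕ → Type v)
    [∀ p, AddCommGroup (V p)] [∀ p, Module k (V p)]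
    (G : GerstenhaberAlgebra k V) (Ω : ℤ → Type w)
    [∀ z, AddCommGroup (Ω z)] [∀ z, Module k (Ω z)] where
  cap : ∀ {p : ℕ} {z : ℤ}, V p →ₗ[k] Ω z →ₗ[k] Ω (z - p)
  lie : ∀ {p : ℕ} {z : ℤ}, V (p + 1) →ₗ[k] Ω z →ₗ[k] Ω (z - p)
  cap_one : ∀ {z : ℤ} (x : Ω z), cap G.one x = dcast (F := Ω) x (by omega)
  cap_mul : ∀ {p q : ℕ} {z : ℤ} (α : V p) (β : V q) (x : Ω z),
      cap (G.mul α β) x = dcast (F := Ω) (cap α (cap β x)) (by omega)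
  lie_bracket : ∀ {p q : ℕ} {z : ℤ} (α : V (p + 1)) (β : V (q + 1)) (x : Ω z),
      lie (p := p + q) (G.bracket α β) x
        = dcast (F := Ω) (lie α (lie β x)) (by omega)
          - ((-1 : ℤ) ^ (p * q)) • dcast (F := Ω) (lie β (lie α x)) (by omega)
  mixed_leibniz : ∀ {p q : ℕ} {z : ℤ} (α : V (p + 1)) (β : V q) (x : Ω z),
      cap β (lie α x)
        = dcast (F := Ω) (cap (-(((-1 : ℤ) ^ ((q + 1) * p)) • G.bracket α β)) x) (by omega)
          + ((-1 : ℤ) ^ (p * q)) • dcast (F := Ω) (lie α (cap β x)) (by omega)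

/-- A (noncommutative) differential calculus: a Gerstenhaber algebra, a Gerstenhaber
module over it, and a differential `B` satisfying the Batalin-Vilkovisky homotopy formula. -/
structure DifferentialCalculus (k : Type u) [CommRing k] (V : ℕ → Type v)
    [∀ p, AddCommGroup (V p)] [∀ p, Module k (V p)] (Ω : ℤ → Type w)
    [∀ z, AddCommGroup (Ω z)] [∀ z, Module k (Ω z)] where
  alg : GerstenhaberAlgebra k V
  mod : GerstenhaberModule k V alg Ω
  Bop : ∀ z : ℤ, Ω z →ₗ[k] Ω (z + 1)
  Bop_sq : ∀ (z : ℤ) (x : Ω z), Bop (z + 1) (Bop z x) = 0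
  homotopy : ∀ {p : ℕ} {z : ℤ} (α : V (p + 1)) (x : Ω z),
      mod.lie α x
        = dcast (F := Ω) (Bop (z - (p + 1)) (mod.cap α x)) (by omega)
          - ((-1 : ℤ) ^ (p + 1)) • dcast (F := Ω) (mod.cap α (Bop z x)) (by omega)
section Bialgebroid

variable (k : Type u) [CommRing k] (A U : Type u) [Ring A] [Algebra k A] [Ring U] [Algebra k U]

/-- The sum `Σ xᵢ ⊗ yᵢ` of a list of pairs, in `U ⊗[k] U`. -/
def listTens (l : List (U × U)) : U ⊗[k] U := (l.map fun p => p.1 ⊗ₜ[k] p.2).sum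

variable {U} in
/-- The `k`-submodule of `U ⊗[k] U` of relators presenting `U ⊗_A U`
(with `◁` on the first factor and `▷` on the second one). -/
def midSpan (src tgt : A → U) : Submodule k (U ⊗[k] U) :=
  Submodule.span k {z : U ⊗[k] U | ∃ x y c, z = (tgt c * x) ⊗ₜ[k] y - x ⊗ₜ[k] (src c * y)}

variable {U} in
/-- The `k`-submodule of `U ⊗[k] U` of relators presenting `U ⊗_{A^op} U`
(with `▸` on the first factor and `◁` on the second one). -/
def opSpan (tgt : A → U) : Submodule k (U ⊗[k] U) :=
  Submodule.span k {z : U ⊗[k] U | ∃ x y c, z = (x * tgt c) ⊗ₜ[k] y - x ⊗ₜ[k] (tgt c * y)}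

variable {U} in
/-- Relators in a triple tensor product presenting `U ⊗_A U ⊗_A U`. -/
def midSpan3 (src tgt : A → U) : Submodule k (U ⊗[k] (U ⊗[k] U)) :=
  Submodule.span k
    ({z : U ⊗[k] (U ⊗[k] U) | ∃ x y w c,
        z = (tgt c * x) ⊗ₜ[k] (y ⊗ₜ[k] w) - x ⊗ₜ[k] ((src c * y) ⊗ₜ[k] w)} ∪
     {z : U ⊗[k] (U ⊗[k] U) | ∃ x y w c,
        z = x ⊗ₜ[k] ((tgt c * y) ⊗ₜ[k] w) - x ⊗ₜ[k] (y ⊗ₜ[k] (src c * w))})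

/-- A left bialgebroid (`×_A`-bialgebra) `U` over a possibly noncommutative base `A`.
The coproduct is recorded through a chosen list `comul u` of Sweedler representatives
`u₍₁₎ ⊗ u₍₂₎`; all coalgebra axioms are imposed modulo the relators presenting the
tensor product `U ⊗_A U` inside `U ⊗[k] U`. -/
structure LeftBialgebroid where
  /-- the source map `s : A → U` -/
  src : A →ₐ[k] U
  /-- the target map `t : A^op → U` -/
  tgt : A →ₗ[k] U
  tgt_one : tgt 1 = 1
  tgt_mul : ∀ a b : A, tgt (a * b) = tgt b * tgt a
  src_tgt_comm : ∀ a b : A, src a * tgt b = tgt b * src a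
  /-- the counit -/
  counit : U →ₗ[k] A
  /-- a choice of Sweedler representatives of the coproduct -/
  comul : U → List (U × U)
  counit_one : counit 1 = 1
  counit_lact : ∀ (a : A) (u : U), counit (src a * u) = a * counit u
  counit_ract : ∀ (a : A) (u : U), counit (tgt a * u) = counit u * a
  counit_mul_src : ∀ u v : U, counit (u * v) = counit (u * src (counit v))
  counit_mul_tgt : ∀ u v : U, counit (u * v) = counit (u * tgt (counit v))
  comul_counit_left : ∀ u : U, ((comul u).map fun p => src (counit p.1) * p.2).sum = u
  comul_counit_right : ∀ u : U, ((comul u).map fun p => tgt (counit p.2) * p.1).sum = u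
  comul_takeuchi : ∀ (u : U) (a : A),
      listTens k U ((comul u).map fun p => (p.1 * tgt a, p.2))
        - listTens k U ((comul u).map fun p => (p.1, p.2 * src a))
        ∈ midSpan k A (src ·) (tgt ·)
  comul_add : ∀ u v : U,
      listTens k U (comul (u + v)) - listTens k U (comul u) - listTens k U (comul v)
        ∈ midSpan k A (src ·) (tgt ·)
  comul_smul : ∀ (c : k) (u : U),
      listTens k U (comul (c • u)) - c • listTens k U (comul u)
        ∈ midSpan k A (src ·) (tgt ·)
  comul_one : listTens k U (comul 1) - (1 : U) ⊗ₜ[k] (1 : U) ∈ midSpan k A (src ·) (tgt ·)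
  comul_mul : ∀ u v : U,
      listTens k U (comul (u * v))
        - ((comul u).map fun p =>
            ((comul v).map fun q => (p.1 * q.1) ⊗ₜ[k] (p.2 * q.2)).sum).sum
        ∈ midSpan k A (src ·) (tgt ·)
  comul_bimod : ∀ (a b : A) (u : U),
      listTens k U (comul (src a * tgt b * u))
        - listTens k U ((comul u).map fun p => (src a * p.1, tgt b * p.2))
        ∈ midSpan k A (src ·) (tgt ·)
  comul_coassoc : ∀ u : U,
      ((comul u).map fun p => ((comul p.1).map fun q => q.1 ⊗ₜ[k] (q.2 ⊗ₜ[k] p.2)).sum).sum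
        - ((comul u).map fun p => ((comul p.2).map fun q => p.1 ⊗ₜ[k] (q.1 ⊗ₜ[k] q.2)).sum).sum
        ∈ midSpan3 k A (src ·) (tgt ·)

variable {k A U}

/-- The data making a left bialgebroid a left Hopf algebroid: a translation map
`u ↦ u₊ ⊗ u₋` (again through a chosen list of representatives), inverting the
Hopf-Galois map, i.e. satisfying Schauenburg's identities. -/
structure HopfData (B : LeftBialgebroid k A U) where
  /-- a choice of representatives `u₊ ⊗ u₋` of the translation map -/
  trans : U → List (U × U)
  trans_add : ∀ u v : U,
      listTens k U (trans (u + v)) - listTens k U (trans u) - listTens k U (trans v)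
        ∈ opSpan k A (B.tgt ·)
  trans_smul : ∀ (c : k) (u : U),
      listTens k U (trans (c • u)) - c • listTens k U (trans u) ∈ opSpan k A (B.tgt ·)
  /-- `u₊₍₁₎ ⊗ u₊₍₂₎ u₋ = u ⊗ 1` -/
  sch_one : ∀ u : U,
      ((trans u).map fun pm =>
          ((B.comul pm.1).map fun xy => xy.1 ⊗ₜ[k] (xy.2 * pm.2)).sum).sum
        - u ⊗ₜ[k] (1 : U) ∈ midSpan k A (B.src ·) (B.tgt ·)
  /-- `u₍₁₎₊ ⊗ u₍₁₎₋ u₍₂₎ = u ⊗ 1` -/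
  sch_two : ∀ u : U,
      ((B.comul u).map fun xy =>
          ((trans xy.1).map fun pm => pm.1 ⊗ₜ[k] (pm.2 * xy.2)).sum).sum
        - u ⊗ₜ[k] (1 : U) ∈ opSpan k A (B.tgt ·)

variable (k) in
/-- A right `U`-module structure on `M`. -/
structure RightUModule (B : LeftBialgebroid k A U) (M : Type u) [AddCommGroup M] [Module k M] where
  act : M →ₗ[k] U →ₗ[k] M
  act_one : ∀ m : M, act m 1 = m
  act_mul : ∀ (m : M) (u v : U), act (act m u) v = act m (u * v)

variable (k) in
/-- Relators in `U ⊗[k] M` presenting `U_◁ ⊗_A ▸M`. -/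
def umSpan (B : LeftBialgebroid k A U) {M : Type u} [AddCommGroup M] [Module k M]
    (R : RightUModule k B M) : Submodule k (U ⊗[k] M) :=
  Submodule.span k {z : U ⊗[k] M | ∃ v m a, z = (B.tgt a * v) ⊗ₜ[k] m - v ⊗ₜ[k] R.act m (B.tgt a)}

variable (k) in
/-- A left `U`-comodule structure on a right `U`-module `M`, making `M` a
module-comodule (with compatible induced left `A`-action). -/
structure ComoduleStr (B : LeftBialgebroid k A U) {M : Type u} [AddCommGroup M] [Module k M]
    (R : RightUModule k B M) where
  /-- a choice of Sweedler representatives `m₍₋₁₎ ⊗ m₍₀₎` of the coaction -/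
  coact : M → List (U × M)
  coact_add : ∀ m m' : M,
      ((coact (m + m')).map fun p => p.1 ⊗ₜ[k] p.2).sum
        - ((coact m).map fun p => p.1 ⊗ₜ[k] p.2).sum
        - ((coact m').map fun p => p.1 ⊗ₜ[k] p.2).sum ∈ umSpan k B R
  coact_smul : ∀ (c : k) (m : M),
      ((coact (c • m)).map fun p => p.1 ⊗ₜ[k] p.2).sum
        - c • ((coact m).map fun p => p.1 ⊗ₜ[k] p.2).sum ∈ umSpan k B R
  coact_counit : ∀ m : M, ((coact m).map fun p => R.act p.2 (B.tgt (B.counit p.1))).sum = m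
  coact_takeuchi : ∀ (m : M) (a : A),
      ((coact m).map fun p => (p.1 * B.tgt a) ⊗ₜ[k] p.2).sum
        - ((coact m).map fun p => p.1 ⊗ₜ[k] R.act p.2 (B.src a)).sum ∈ umSpan k B R

variable (k) in
/-- The anti Yetter-Drinfel'd condition for a module-comodule over a left Hopf algebroid. -/
def IsAYD (B : LeftBialgebroid k A U) (H : HopfData B) {M : Type u} [AddCommGroup M] [Module k M]
    (R : RightUModule k B M) (C : ComoduleStr k B R) : Prop :=
  (∀ (m : M) (u : U),
      ((C.coact (R.act m u)).map fun p => p.1 ⊗ₜ[k] p.2).sum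
        - ((H.trans u).map fun pm =>
            ((C.coact m).map fun xm =>
              ((B.comul pm.1).map fun y =>
                (pm.2 * xm.1 * y.1) ⊗ₜ[k] R.act xm.2 y.2).sum).sum).sum
        ∈ umSpan k B R) ∧
  (∀ (a b : A) (m : M),
      ((C.coact (R.act m (B.src b * B.tgt a))).map fun p => p.1 ⊗ₜ[k] p.2).sum
        - ((C.coact m).map fun p => (B.src a * B.tgt b * p.1) ⊗ₜ[k] p.2).sum
        ∈ umSpan k B R)

variable (k) in
/-- Stability of a module-comodule: `m₍₀₎ m₍₋₁₎ = m`. -/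
def IsStable (B : LeftBialgebroid k A U) {M : Type u} [AddCommGroup M] [Module k M]
    (R : RightUModule k B M) (C : ComoduleStr k B R) : Prop :=
  ∀ m : M, ((C.coact m).map fun p => R.act p.2 p.1).sum = m

end Bialgebroid
section Cochains

variable {k : Type u} [CommRing k] {A U : Type u} [Ring A] [Algebra k A] [Ring U] [Algebra k U]

variable (k) in
/-- The conditions singling out the `p`-cochains `C^p(U,A) = Hom_{A^op}((U^{⊗_{A^op} p})_◁, A)`
inside all maps `(ℕ → U) → A` (a `p`-cochain only depends on the first `p` entries). -/
def cochainCond (B : LeftBialgebroid k A U) (p : ℕ) (φ : (ℕ → U) → A) : Prop :=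
  (∀ u v : ℕ → U, (∀ i < p, u i = v i) → φ u = φ v) ∧
  (∀ (u : ℕ → U) (i : ℕ), i < p → ∀ x y : U,
      φ (update u i (x + y)) = φ (update u i x) + φ (update u i y)) ∧
  (∀ (u : ℕ → U) (i : ℕ), i < p → ∀ (c : k) (x : U),
      φ (update u i (c • x)) = c • φ (update u i x)) ∧
  (∀ (u : ℕ → U) (i : ℕ), i + 1 < p → ∀ a : A,
      φ (update u i (u i * B.tgt a)) = φ (update u (i + 1) (B.tgt a * u (i + 1)))) ∧
  (∀ (u : ℕ → U), 0 < p → ∀ a : A,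
      φ (update u (p - 1) (B.tgt a * u (p - 1))) = φ u * a)

variable (k) in
/-- The `k`-module of `p`-cochains. -/
def cochainSub (B : LeftBialgebroid k A U) (p : ℕ) : Submodule k ((ℕ → U) → A) where
  carrier := {φ | cochainCond k B p φ}
  add_mem' := by
    rintro φ ψ ⟨h1, h2, h3, h4, h5⟩ ⟨g1, g2, g3, g4, g5⟩
    refine ⟨fun u v h => ?_, fun u i hi x y => ?_, fun u i hi c x => ?_,
      fun u i hi a => ?_, fun u hp a => ?_⟩ <;> simp only [Pi.add_apply]
    · rw [h1 u v h, g1 u v h]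
    · rw [h2 u i hi x y, g2 u i hi x y]; abel
    · rw [h3 u i hi c x, g3 u i hi c x, smul_add]
    · rw [h4 u i hi a, g4 u i hi a]
    · rw [h5 u hp a, g5 u hp a, add_mul]
  zero_mem' := by
    refine ⟨fun u v h => rfl, fun u i hi x y => ?_, fun u i hi c x => ?_,
      fun u i hi a => rfl, fun u hp a => ?_⟩ <;> simp
  smul_mem' := by
    rintro c φ ⟨h1, h2, h3, h4, h5⟩
    refine ⟨fun u v h => ?_, fun u i hi x y => ?_, fun u i hi c' x => ?_,
      fun u i hi a => ?_, fun u hp a => ?_⟩ <;> simp only [Pi.smul_apply]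
    · rw [h1 u v h]
    · rw [h2 u i hi x y, smul_add]
    · rw [h3 u i hi c' x, smul_comm]
    · rw [h4 u i hi a]
    · rw [h5 u hp a, smul_mul_assoc]

variable (k) in
/-- Reduced (normalised) cochains: those killed by all codegeneracies. -/
def redCochainSub (p : ℕ) : Submodule k ((ℕ → U) → A) where
  carrier := {φ | ∀ (u : ℕ → U) (i : ℕ), i < p → φ (update u i 1) = 0}
  add_mem' := by
    intro φ ψ hφ hψ
    intro u i hi; simp only [Pi.add_apply, hφ u i hi, hψ u i hi, add_zero]
  zero_mem' := by intro u i hi; rfl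
  smul_mem' := by
    intro c φ hφ u i hi; simp only [Pi.smul_apply, hφ u i hi, smul_zero]

variable (k) in
/-- The operator `D_φ(u¹,…,u^p) = φ(u¹₍₁₎,…,u^p₍₁₎) ▷ u¹₍₂₎ ⋯ u^p₍₂₎`. -/
def Dop (B : LeftBialgebroid k A U) (p : ℕ) (φ : (ℕ → U) → A) (u : ℕ → U) : U :=
  ∑ j : (∀ i : Fin p, Fin ((B.comul (u i.val)).length)),
    B.src (φ fun l => if h : l < p then ((B.comul (u l)).get (j ⟨l, h⟩)).1 else u l) *
      (List.ofFn fun i : Fin p => ((B.comul (u i.val)).get (j i)).2).prod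

variable (k) in
/-- The cosimplicial differential `δ` on cochains. -/
def deltaFun (B : LeftBialgebroid k A U) (p : ℕ) (φ : (ℕ → U) → A) : (ℕ → U) → A :=
  if p = 0 then
    fun u => B.counit (u 0 * B.src (φ fun _ => 1)) - (φ fun _ => 1) * B.counit (u 0)
  else
    fun u =>
      B.counit (u 0 * B.src (φ fun i => u (i + 1)))
        + (∑ i ∈ Finset.Icc 1 p, ((-1 : ℤ) ^ i) •
            φ (fun l => if l < i - 1 then u l else if l = i - 1 then u (i - 1) * u i
                else u (l + 1)))
        + ((-1 : ℤ) ^ (p + 1)) •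
            φ (fun l => if l = p - 1 then u (p - 1) * B.tgt (B.counit (u p)) else u l)

variable (k) in
lemma deltaFun_add (B : LeftBialgebroid k A U) (p : ℕ) (φ ψ : (ℕ → U) → A) :
    deltaFun k B p (φ + ψ) = deltaFun k B p φ + deltaFun k B p ψ := by
  unfold deltaFun
  split
  · funext u
    simp only [Pi.add_apply, map_add, mul_add, add_mul]
    abel
  · funext u
    simp only [Pi.add_apply, map_add, mul_add, smul_add, Finset.sum_add_distrib]
    abel

variable (k) in
lemma deltaFun_smul (B : LeftBialgebroid k A U) (p : ℕ) (c : k) (φ : (ℕ → U) → A) :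
    deltaFun k B p (c • φ) = c • deltaFun k B p φ := by
  unfold deltaFun
  split
  · funext u
    simp only [Pi.smul_apply, map_smul, mul_smul_comm, smul_mul_assoc, smul_sub]
  · funext u
    simp only [Pi.smul_apply, map_smul, mul_smul_comm, smul_add, Finset.smul_sum,
      smul_comm ((-1 : ℤ) ^ _) c]

variable (k) in
lemma deltaFun_zero (B : LeftBialgebroid k A U) (p : ℕ) :
    deltaFun k B p (0 : (ℕ → U) → A) = 0 := by
  have h : (0 : (ℕ → U) → A) = (0 : k) • (0 : (ℕ → U) → A) := by simp
  rw [h, deltaFun_smul]; simp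

variable (k) in
/-- Cocycles: cochains killed by `δ`. -/
def cocycles (B : LeftBialgebroid k A U) (p : ℕ) : Submodule k ((ℕ → U) → A) where
  carrier := {φ | φ ∈ cochainSub k B p ∧ deltaFun k B p φ = 0}
  add_mem' := fun hφ hψ => ⟨(cochainSub k B _).add_mem hφ.1 hψ.1, by
    rw [deltaFun_add, hφ.2, hψ.2, add_zero]⟩
  zero_mem' := ⟨(cochainSub k B _).zero_mem, deltaFun_zero k B _⟩
  smul_mem' := fun c φ hφ => ⟨(cochainSub k B _).smul_mem c hφ.1, by
    rw [deltaFun_smul, hφ.2, smul_zero]⟩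

variable (k) in
/-- Coboundaries: images of cochains under `δ`. -/
def cobounds (B : LeftBialgebroid k A U) : ℕ → Submodule k ((ℕ → U) → A)
  | 0 => ⊥
  | (q + 1) =>
    { carrier := {ψ | ∃ φ ∈ cochainSub k B q, ψ = deltaFun k B q φ}
      add_mem' := by
        rintro ψ₁ ψ₂ ⟨φ₁, hφ₁, rfl⟩ ⟨φ₂, hφ₂, rfl⟩
        exact ⟨φ₁ + φ₂, (cochainSub k B q).add_mem hφ₁ hφ₂, (deltaFun_add k B q φ₁ φ₂).symm⟩
      zero_mem' := ⟨0, (cochainSub k B q).zero_mem, (deltaFun_zero k B q).symm⟩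
      smul_mem' := by
        rintro c ψ ⟨φ, hφ, rfl⟩
        exact ⟨c • φ, (cochainSub k B q).smul_mem c hφ, (deltaFun_smul k B q c φ).symm⟩ }

variable (k) in
/-- The cohomology `H^p(U,A)` of the cochain complex `(C^•(U,A), δ)`. -/
abbrev Hcoh (B : LeftBialgebroid k A U) (p : ℕ) :=
  ↥(cocycles k B p) ⧸ Submodule.comap (cocycles k B p).subtype (cobounds k B p)

variable (k) in
/-- The cohomology class of a cocycle. -/
def clsH (B : LeftBialgebroid k A U) (p : ℕ) (φ : (ℕ → U) → A) (h : φ ∈ cocycles k B p) :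
    Hcoh k B p := Submodule.Quotient.mk ⟨φ, h⟩

variable (k) in
/-- The cup product `(φ ⌣ ψ)(u¹,…,u^{p+q}) = φ(u¹,…,u^{p-1}, ψ(u^{p+1},…,u^{p+q}) ▸ u^p)`. -/
def cupFun (B : LeftBialgebroid k A U) (p q : ℕ) (φ ψ : (ℕ → U) → A) : (ℕ → U) → A :=
  if p = 0 then fun u => (φ fun _ => 1) * ψ u
  else fun u =>
    φ fun l => if l = p - 1 then u (p - 1) * B.tgt (ψ fun i => u (p + i)) else u l

variable (k) in
/-- The Gerstenhaber product `φ ∘ᵢ ψ`, inserting `D_ψ` in the `i`-th slot (`1 ≤ i ≤ p`). -/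
def circFun (B : LeftBialgebroid k A U) (p q i : ℕ) (φ ψ : (ℕ → U) → A) : (ℕ → U) → A :=
  if p = 0 then 0
  else fun u =>
    φ fun l => if l < i - 1 then u l
      else if l = i - 1 then Dop k B q ψ (fun r => u (i - 1 + r))
      else u (l + q - 1)

variable (k) in
/-- `φ ∘̄ ψ = (-1)^{|p||q|} Σᵢ (-1)^{|q||i|} φ ∘ᵢ ψ`. -/
def barCircFun (B : LeftBialgebroid k A U) (p q : ℕ) (φ ψ : (ℕ → U) → A) : (ℕ → U) → A :=
  ((-1 : ℤ) ^ ((p + 1) * (q + 1))) •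
    ∑ i ∈ Finset.Icc 1 p, ((-1 : ℤ) ^ ((q + 1) * (i - 1))) • circFun k B p q i φ ψ

variable (k) in
/-- The Gerstenhaber bracket `{φ,ψ} = φ ∘̄ ψ - (-1)^{|p||q|} ψ ∘̄ φ`. -/
def bracketFun (B : LeftBialgebroid k A U) (p q : ℕ) (φ ψ : (ℕ → U) → A) : (ℕ → U) → A :=
  barCircFun k B p q φ ψ - ((-1 : ℤ) ^ ((p + 1) * (q + 1))) • barCircFun k B q p ψ φ

variable (k) in
/-- The distinguished element `μ = ε ∘ m_U ∈ C²(U,A)`. -/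
def muFun (B : LeftBialgebroid k A U) : (ℕ → U) → A := fun u => B.counit (u 0 * u 1)

end Cochains
section Chains

variable {k : Type u} [CommRing k] {A U : Type u} [Ring A] [Algebra k A] [Ring U] [Algebra k U]
variable {M : Type u} [AddCommGroup M] [Module k M]

variable (k M) in
/-- Generators of the free module underlying the chain modules. -/
def freeGen (m : M) (u : ℕ → U) : (M × (ℕ → U)) →₀ k := Finsupp.single (m, u) 1

variable (k) in
/-- The relators presenting `C_n(U,M) = M ⊗_{A^op} (▸U◁)^{⊗_{A^op} n}` as a quotient of
the free `k`-module on pairs `(m, (u¹,…,uⁿ))` (recorded as sequences `ℕ → U`). -/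
def chainRel (B : LeftBialgebroid k A U) (R : RightUModule k B M) (n : ℕ) :
    Submodule k ((M × (ℕ → U)) →₀ k) :=
  Submodule.span k (
    {x | ∃ m u v, (∀ i < n, u i = v i) ∧ x = freeGen k M m u - freeGen k M m v} ∪
    {x | ∃ m m' u, x = freeGen k M (m + m') u - freeGen k M m u - freeGen k M m' u} ∪
    {x | ∃ (c : k), ∃ m u, x = freeGen k M (c • m) u - c • freeGen k M m u} ∪
    {x | ∃ m u, ∃ i : ℕ, i < n ∧ ∃ y z : U,
        x = freeGen k M m (update u i (y + z)) - freeGen k M m (update u i y)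
            - freeGen k M m (update u i z)} ∪
    {x | ∃ m u, ∃ i : ℕ, i < n ∧ ∃ (c : k) (y : U),
        x = freeGen k M m (update u i (c • y)) - c • freeGen k M m (update u i y)} ∪
    {x | ∃ m u a, 0 < n ∧
        x = freeGen k M (R.act m (B.tgt a)) u - freeGen k M m (update u 0 (B.tgt a * u 0))} ∪
    {x | ∃ m u a, ∃ i : ℕ, i + 1 < n ∧
        x = freeGen k M m (update u i (u i * B.tgt a))
            - freeGen k M m (update u (i + 1) (B.tgt a * u (i + 1)))})

variable (k) in
/-- The chain module `C_n(U,M)`. -/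
abbrev Chn (B : LeftBialgebroid k A U) (R : RightUModule k B M) (n : ℕ) :=
  ((M × (ℕ → U)) →₀ k) ⧸ chainRel k B R n

variable (k) in
/-- The chain modules, indexed over `ℤ` (trivial in negative degrees). -/
def ChZ (B : LeftBialgebroid k A U) (R : RightUModule k B M) : ℤ → Type u := fun z =>
  match z with
  | .ofNat n => Chn k B R n
  | .negSucc _ => PUnit

instance (B : LeftBialgebroid k A U) (R : RightUModule k B M) (z : ℤ) :
    AddCommGroup (ChZ k B R z) :=
  match z with
  | .ofNat n => inferInstanceAs (AddCommGroup (Chn k B R n))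
  | .negSucc _ => inferInstanceAs (AddCommGroup PUnit)

instance (B : LeftBialgebroid k A U) (R : RightUModule k B M) (z : ℤ) :
    Module k (ChZ k B R z) :=
  match z with
  | .ofNat n => inferInstanceAs (Module k (Chn k B R n))
  | .negSucc _ => inferInstanceAs (Module k PUnit.{u + 1})

variable (k) in
/-- The chain `(m, u¹, …, uⁿ) ∈ C_n(U,M)` (in degree `z ≥ 0`; trivial otherwise). -/
def cgen (B : LeftBialgebroid k A U) (R : RightUModule k B M) (z : ℤ) (m : M) (u : ℕ → U) :
    ChZ k B R z :=
  match z with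
  | .ofNat _ => Submodule.Quotient.mk (freeGen k M m u)
  | .negSucc _ => PUnit.unit

end Chains
section ChainOps

variable {k : Type u} [CommRing k] {A U : Type u} [Ring A] [Algebra k A] [Ring U] [Algebra k U]
variable {M : Type u} [AddCommGroup M] [Module k M]

variable (k) in
/-- The simplicial structure of `C_•(U,M)`, together with the cap product and the
insertion operators `φ •ᵢ -`, given by their values on generators. -/
structure SimplicialOps (B : LeftBialgebroid k A U) (R : RightUModule k B M) where
  face : ∀ (z : ℤ) (_ : ℕ), ChZ k B R z →ₗ[k] ChZ k B R (z - 1)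
  degen : ∀ (z : ℤ) (_ : ℕ), ChZ k B R z →ₗ[k] ChZ k B R (z + 1)
  cap : ∀ (z : ℤ) (p : ℕ), ((ℕ → U) → A) → (ChZ k B R z →ₗ[k] ChZ k B R (z - p))
  bullet : ∀ (z : ℤ) (p i : ℕ), ((ℕ → U) → A) → (ChZ k B R z →ₗ[k] ChZ k B R (z - p + 1))
  face_zero_base : ∀ (m : M) (u : ℕ → U),
      face (1 : ℤ) 0 (cgen k B R 1 m u)
        = cgen k B R ((1 : ℤ) - 1) (R.act m (B.tgt (B.counit (u 0)))) u
  face_zero : ∀ (n : ℕ) (m : M) (u : ℕ → U),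
      face ((n : ℤ) + 2) 0 (cgen k B R ((n : ℤ) + 2) m u)
        = cgen k B R ((n : ℤ) + 2 - 1) m
            (fun l => if l = n then u n * B.tgt (B.counit (u (n + 1))) else u l)
  face_mid : ∀ (n i : ℕ), 1 ≤ i → i ≤ n → ∀ (m : M) (u : ℕ → U),
      face ((n : ℤ) + 1) i (cgen k B R ((n : ℤ) + 1) m u)
        = cgen k B R ((n : ℤ) + 1 - 1) m
            (fun l => if l < n - i then u l
              else if l = n - i then u (n - i) * u (n - i + 1) else u (l + 1))
  face_last : ∀ (n : ℕ) (m : M) (u : ℕ → U),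
      face ((n : ℤ) + 1) (n + 1) (cgen k B R ((n : ℤ) + 1) m u)
        = cgen k B R ((n : ℤ) + 1 - 1) (R.act m (u 0)) (fun l => u (l + 1))
  degen_gen : ∀ (n j : ℕ), j ≤ n → ∀ (m : M) (u : ℕ → U),
      degen (n : ℤ) j (cgen k B R (n : ℤ) m u)
        = cgen k B R ((n : ℤ) + 1) m
            (fun l => if l < n - j then u l else if l = n - j then 1 else u (l - 1))
  cap_add : ∀ (z : ℤ) (p : ℕ) (φ ψ : (ℕ → U) → A),
      cap z p (φ + ψ) = cap z p φ + cap z p ψ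
  cap_smul : ∀ (z : ℤ) (p : ℕ) (c : k) (φ : (ℕ → U) → A), cap z p (c • φ) = c • cap z p φ
  cap_gen : ∀ (n p : ℕ), p < n → ∀ φ ∈ cochainSub k B p, ∀ (m : M) (u : ℕ → U),
      cap (n : ℤ) p φ (cgen k B R (n : ℤ) m u)
        = cgen k B R ((n : ℤ) - p) m
            (fun l => if l = n - p - 1 then
                u (n - p - 1) * B.tgt (φ fun i => u (n - p + i)) else u l)
  cap_top : ∀ (n : ℕ), ∀ φ ∈ cochainSub k B n, ∀ (m : M) (u : ℕ → U),
      cap (n : ℤ) n φ (cgen k B R (n : ℤ) m u)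
        = cgen k B R ((n : ℤ) - n) (R.act m (B.tgt (φ u))) u
  bullet_add : ∀ (z : ℤ) (p i : ℕ) (φ ψ : (ℕ → U) → A),
      bullet z p i (φ + ψ) = bullet z p i φ + bullet z p i ψ
  bullet_smul : ∀ (z : ℤ) (p i : ℕ) (c : k) (φ : (ℕ → U) → A),
      bullet z p i (c • φ) = c • bullet z p i φ
  bullet_gen : ∀ (n p i : ℕ), p ≤ n → 1 ≤ i → i + p ≤ n + 1 → ∀ φ ∈ cochainSub k B p,
      ∀ (m : M) (u : ℕ → U),
      bullet (n : ℤ) p i φ (cgen k B R (n : ℤ) m u)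
        = cgen k B R ((n : ℤ) - p + 1) m
            (fun l => if l < i - 1 then u l
              else if l = i - 1 then Dop k B p φ (fun r => u (i - 1 + r))
              else u (l + p - 1))

variable (k) in
/-- The para-cyclic structure on `C_•(U,M)` for a module-comodule `M` over a left
Hopf algebroid, extending the simplicial operators by the cyclic operator `t`. -/
structure ParaCyclicOps (B : LeftBialgebroid k A U) (H : HopfData B)
    (R : RightUModule k B M) (C : ComoduleStr k B R) extends SimplicialOps k B R where
  cyc : ∀ z : ℤ, ChZ k B R z →ₗ[k] ChZ k B R z
  cyc_gen : ∀ (n : ℕ) (hn : 0 < n) (m : M) (u : ℕ → U),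
      cyc (n : ℤ) (cgen k B R (n : ℤ) m u)
        = ∑ c : Fin (C.coact m).length,
          ∑ j : (∀ i : Fin n, Fin ((H.trans (u i.val)).length)),
            cgen k B R (n : ℤ)
              (R.act ((C.coact m).get c).2 (((H.trans (u 0)).get (j ⟨0, hn⟩)).1))
              (fun l =>
                if h : l + 1 < n then ((H.trans (u (l + 1))).get (j ⟨l + 1, h⟩)).1
                else if l = n - 1 then
                  (List.ofFn fun i : Fin n =>
                      ((H.trans (u (n - 1 - i.val))).get (j ⟨n - 1 - i.val, by omega⟩)).2).prod
                    * ((C.coact m).get c).1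
                else u l)

namespace HopfCalc

variable {B : LeftBialgebroid k A U} {H : HopfData B} {R : RightUModule k B M}
  {C : ComoduleStr k B R}

/-- The simplicial differential `b = Σ (-1)ⁱ dᵢ`. -/
def bOpZ (S : SimplicialOps k B R) (z : ℤ) : ChZ k B R z →ₗ[k] ChZ k B R (z - 1) :=
  ∑ i ∈ Finset.range (z.toNat + 1), ((-1 : ℤ) ^ i) • S.face z i

/-- The operator `T = t^{n+1}`. -/
def TOpZ (P : ParaCyclicOps k B H R C) (z : ℤ) : ChZ k B R z →ₗ[k] ChZ k B R z :=
  (P.cyc z) ^ (z.toNat + 1)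

/-- The submodule `im(id - T)`. -/
def WZ (P : ParaCyclicOps k B H R C) (z : ℤ) : Submodule k (ChZ k B R z) :=
  LinearMap.range (LinearMap.id - TOpZ P z)

/-- The norm operator `N = Σ (-1)^{in} tⁱ`. -/
def NOpZ (P : ParaCyclicOps k B H R C) (z : ℤ) : ChZ k B R z →ₗ[k] ChZ k B R z :=
  ∑ i ∈ Finset.range (z.toNat + 1), ((-1 : ℤ) ^ (i * z.toNat)) • (P.cyc z) ^ i

/-- The extra degeneracy `s₋₁ = t s_n`. -/
def sm1 (P : ParaCyclicOps k B H R C) (z : ℤ) : ChZ k B R z →ₗ[k] ChZ k B R (z + 1) :=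
  P.cyc (z + 1) ∘ₗ P.degen z z.toNat

/-- The cyclic differential `B = (id - t) s₋₁ N`. -/
def BOpZ (P : ParaCyclicOps k B H R C) (z : ℤ) : ChZ k B R z →ₗ[k] ChZ k B R (z + 1) :=
  (LinearMap.id - P.cyc (z + 1)) ∘ₗ sm1 P z ∘ₗ NOpZ P z

/-- The cyclic differential in the form `B = s₋₁ N` valid on the reduced complex. -/
def BredZ (P : ParaCyclicOps k B H R C) (z : ℤ) : ChZ k B R z →ₗ[k] ChZ k B R (z + 1) :=
  sm1 P z ∘ₗ NOpZ P z

/-- The operator `D'_φ = φ •_{n-p+1} -`. -/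
def DlastZ (S : SimplicialOps k B R) (z : ℤ) (p : ℕ) (φ : (ℕ → U) → A) :
    ChZ k B R z →ₗ[k] ChZ k B R (z - p + 1) :=
  S.bullet z p ((z - (p : ℤ) + 1).toNat) φ

/-- The Lie derivative `L_φ`. -/
def lieOpZ (P : ParaCyclicOps k B H R C) (z : ℤ) (p : ℕ) (φ : (ℕ → U) → A) :
    ChZ k B R z →ₗ[k] ChZ k B R (z - p + 1) :=
  if (p : ℤ) ≤ z then
    (∑ i ∈ Finset.Icc 1 ((z - (p : ℤ) + 1).toNat),
        ((-1 : ℤ) ^ ((p + 1) * (z.toNat - i + 1))) •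
          (((P.cyc (z - p + 1)) ^ ((z - (p : ℤ) + 1).toNat - i)) ∘ₗ
            (DlastZ P.toSimplicialOps z p φ ∘ₗ ((P.cyc z) ^ (i + p)))))
    + ∑ i ∈ Finset.Icc 1 p,
        ((-1 : ℤ) ^ (z.toNat * (i - 1) + p + 1)) •
          (((P.cyc (z - p + 1)) ^ ((z - (p : ℤ) + 1).toNat)) ∘ₗ
            (DlastZ P.toSimplicialOps z p φ ∘ₗ ((P.cyc z) ^ i)))
  else if (p : ℤ) = z + 1 then
    ((-1 : ℤ) ^ (p + 1)) •
      ((dEquiv k (ChZ k B R) (by omega : z + 1 - (p : ℤ) = z - p + 1)).toLinearMap ∘ₗ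
        (P.cap (z + 1) p φ ∘ₗ BOpZ P z))
  else 0

/-- The operator `S_φ`. -/
def SOpZ (P : ParaCyclicOps k B H R C) (z : ℤ) (p : ℕ) (φ : (ℕ → U) → A) :
    ChZ k B R z →ₗ[k] ChZ k B R (z - p + 2) :=
  if (p : ℤ) ≤ z then
    ∑ j ∈ Finset.range ((z - (p : ℤ)).toNat + 1), ∑ i ∈ Finset.range (j + 1),
      ((-1 : ℤ) ^ (z.toNat * j + (p + 1) * i)) •
        ((dEquiv k (ChZ k B R) (by omega : z - (p : ℤ) + 1 + 1 = z - p + 2)).toLinearMap ∘ₗ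
          (sm1 P (z - p + 1) ∘ₗ (((P.cyc (z - p + 1)) ^ ((z - (p : ℤ) - i).toNat)) ∘ₗ
          (DlastZ P.toSimplicialOps z p φ ∘ₗ ((P.cyc z) ^ (z.toNat + i - j + 1))))))
  else 0

/-- Cycles of the cyclic quotient complex `C_•^{cyc}(U,M)`. -/
def ZCy (P : ParaCyclicOps k B H R C) (z : ℤ) : Submodule k (ChZ k B R z) :=
  Submodule.comap (bOpZ P.toSimplicialOps z) (WZ P (z - 1))

/-- Boundaries of the cyclic quotient complex. -/
def BdCy (P : ParaCyclicOps k B H R C) (z : ℤ) : Submodule k (ChZ k B R z) :=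
  WZ P z ⊔ LinearMap.range
    ((dEquiv k (ChZ k B R) (by omega : z + 1 - 1 = z)).toLinearMap ∘ₗ
      bOpZ P.toSimplicialOps (z + 1))

/-- The homology `Ĥ^M_•(U)` of the cyclic quotient complex `(C_•^{cyc}(U,M), b)`. -/
abbrev Hcyc (P : ParaCyclicOps k B H R C) (z : ℤ) :=
  ↥(ZCy P z) ⧸ Submodule.comap (ZCy P z).subtype (BdCy P z)

/-- The homology class of a cycle. -/
def clsHcyc (P : ParaCyclicOps k B H R C) (z : ℤ) (x : ChZ k B R z) (hx : x ∈ ZCy P z) :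
    Hcyc P z := Submodule.Quotient.mk ⟨x, hx⟩

/-- Cycles of the plain complex `(C_•(U,M), b)`. -/
def ZPl (S : SimplicialOps k B R) (z : ℤ) : Submodule k (ChZ k B R z) :=
  LinearMap.ker (bOpZ S z)

/-- Boundaries of the plain complex `(C_•(U,M), b)`. -/
def BdPl (S : SimplicialOps k B R) (z : ℤ) : Submodule k (ChZ k B R z) :=
  LinearMap.range
    ((dEquiv k (ChZ k B R) (by omega : z + 1 - 1 = z)).toLinearMap ∘ₗ bOpZ S (z + 1))

/-- The homology `H_•(U,M)` of the complex `(C_•(U,M), b)`. -/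
abbrev HPl (S : SimplicialOps k B R) (z : ℤ) :=
  ↥(ZPl S z) ⧸ Submodule.comap (ZPl S z).subtype (BdPl S z)

/-- The homology class of a cycle. -/
def clsHPl (S : SimplicialOps k B R) (z : ℤ) (x : ChZ k B R z) (hx : x ∈ ZPl S z) :
    HPl S z := Submodule.Quotient.mk ⟨x, hx⟩

/-- The degenerate subcomplex. -/
def DegSub (S : SimplicialOps k B R) (z : ℤ) : Submodule k (ChZ k B R z) :=
  ⨆ j : Fin z.toNat, LinearMap.range
    ((dEquiv k (ChZ k B R) (by omega : z - 1 + 1 = z)).toLinearMap ∘ₗ S.degen (z - 1) j.val)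

/-- The subcomplex `C^•_M(U)` of cochains whose insertion operators preserve `im(id - T)`. -/
def CMsub (P : ParaCyclicOps k B H R C) (p : ℕ) : Submodule k ((ℕ → U) → A) where
  carrier := {φ | ∀ (z : ℤ) (i : ℕ), ∀ x ∈ WZ P z, P.bullet z p i φ x ∈ WZ P (z - p + 1)}
  add_mem' := by
    intro φ ψ hφ hψ z i x hx
    rw [P.bullet_add]
    exact (WZ P _).add_mem (hφ z i x hx) (hψ z i x hx)
  zero_mem' := by
    intro z i x hx
    have h0 : P.bullet z p i (0 : (ℕ → U) → A) = 0 := by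
      have h : (0 : (ℕ → U) → A) = (0 : k) • (0 : (ℕ → U) → A) := by simp
      rw [h, P.bullet_smul]; simp
    rw [h0]; simp only [LinearMap.zero_apply]; exact (WZ P _).zero_mem
  smul_mem' := by
    intro c φ hφ z i x hx
    rw [P.bullet_smul]
    exact (WZ P _).smul_mem c (hφ z i x hx)

/-- Cocycles in `C^•_M(U)`. -/
def cocyclesM (P : ParaCyclicOps k B H R C) (p : ℕ) : Submodule k ((ℕ → U) → A) :=
  cocycles k B p ⊓ CMsub P p

/-- Coboundaries in `C^•_M(U)`. -/
def coboundsM (P : ParaCyclicOps k B H R C) : ℕ → Submodule k ((ℕ → U) → A)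
  | 0 => ⊥
  | (q + 1) =>
    { carrier := {ψ | ∃ φ ∈ cochainSub k B q ⊓ CMsub P q, ψ = deltaFun k B q φ}
      add_mem' := by
        rintro ψ₁ ψ₂ ⟨φ₁, hφ₁, rfl⟩ ⟨φ₂, hφ₂, rfl⟩
        exact ⟨φ₁ + φ₂, Submodule.add_mem _ hφ₁ hφ₂, (deltaFun_add k B q φ₁ φ₂).symm⟩
      zero_mem' := ⟨0, Submodule.zero_mem _, (deltaFun_zero k B q).symm⟩
      smul_mem' := by
        rintro c ψ ⟨φ, hφ, rfl⟩
        exact ⟨c • φ, Submodule.smul_mem _ c hφ, (deltaFun_smul k B q c φ).symm⟩ }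

/-- The cohomology `H^•_M(U)` of the subcomplex `C^•_M(U) ⊆ C^•(U,A)`. -/
abbrev HcohM (P : ParaCyclicOps k B H R C) (p : ℕ) :=
  ↥(cocyclesM P p) ⧸ Submodule.comap (cocyclesM P p).subtype (coboundsM P p)

/-- The cohomology class of a cocycle in `C^•_M(U)`. -/
def clsHM (P : ParaCyclicOps k B H R C) (p : ℕ) (φ : (ℕ → U) → A) (h : φ ∈ cocyclesM P p) :
    HcohM P p := Submodule.Quotient.mk ⟨φ, h⟩

end HopfCalc

end ChainOps

section BarResolution

variable {k : Type u} [CommRing k] {A U : Type u} [Ring A] [Algebra k A] [Ring U] [Algebra k U]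

/-- `U` as a right module over itself (used for the bar resolution `P_n = U^{⊗(n+1)}`). -/
def barR (B : LeftBialgebroid k A U) : RightUModule k B U where
  act := LinearMap.mul k U
  act_one := fun m => mul_one m
  act_mul := fun m u v => mul_assoc m u v

variable (k) in
/-- The bar resolution module `P_n = U^{⊗_{A^op}(n+1)}`. -/
abbrev BarC (B : LeftBialgebroid k A U) (n : ℕ) := Chn k B (barR B) n

variable (k) in
/-- The generator `(u⁰, u¹, …, uⁿ) ∈ P_n`. -/
def bgenC (B : LeftBialgebroid k A U) (n : ℕ) (u : ℕ → U) : BarC k B n :=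
  Submodule.Quotient.mk (freeGen k U (u 0) (fun l => u (l + 1)))

variable (k) in
/-- Relators presenting `P_i ⊗_A P_j` as a quotient of `P_i ⊗[k] P_j`. -/
def barTRel (B : LeftBialgebroid k A U) (i j : ℕ) : Submodule k (BarC k B i ⊗[k] BarC k B j) :=
  Submodule.span k {z | ∃ (a : A) (v w : ℕ → U),
    z = (bgenC k B i (fun l => if l = 0 then B.tgt a * v 0 else v l)) ⊗ₜ[k] (bgenC k B j w)
        - (bgenC k B i v) ⊗ₜ[k] (bgenC k B j (fun l => if l = 0 then B.src a * w 0 else w l))}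

variable (k) in
/-- The `A`-module tensor product `P_i ⊗_A P_j`. -/
abbrev BarT (B : LeftBialgebroid k A U) (i j : ℕ) :=
  (BarC k B i ⊗[k] BarC k B j) ⧸ barTRel k B i j

variable (k) in
/-- The class of a simple tensor in `P_i ⊗_A P_j`. -/
def mkT (B : LeftBialgebroid k A U) (i j : ℕ) (x : BarC k B i) (y : BarC k B j) :
    BarT k B i j := Submodule.Quotient.mk (x ⊗ₜ[k] y)

variable (k) in
/-- Relators presenting `P_a ⊗_A P_b ⊗_A P_c`. -/
def barT3Rel (B : LeftBialgebroid k A U) (a b c : ℕ) :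
    Submodule k (BarC k B a ⊗[k] (BarC k B b ⊗[k] BarC k B c)) :=
  Submodule.span k
    ({z | ∃ (s : A) (v w x : ℕ → U),
        z = (bgenC k B a (fun l => if l = 0 then B.tgt s * v 0 else v l)) ⊗ₜ[k]
              ((bgenC k B b w) ⊗ₜ[k] (bgenC k B c x))
            - (bgenC k B a v) ⊗ₜ[k]
              ((bgenC k B b (fun l => if l = 0 then B.src s * w 0 else w l)) ⊗ₜ[k]
                (bgenC k B c x))} ∪
     {z | ∃ (s : A) (v w x : ℕ → U),
        z = (bgenC k B a v) ⊗ₜ[k]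
              ((bgenC k B b (fun l => if l = 0 then B.tgt s * w 0 else w l)) ⊗ₜ[k]
                (bgenC k B c x))
            - (bgenC k B a v) ⊗ₜ[k]
              ((bgenC k B b w) ⊗ₜ[k]
                (bgenC k B c (fun l => if l = 0 then B.src s * x 0 else x l)))})

variable (k) in
/-- The triple tensor product `P_a ⊗_A P_b ⊗_A P_c`. -/
abbrev BarT3 (B : LeftBialgebroid k A U) (a b c : ℕ) :=
  (BarC k B a ⊗[k] (BarC k B b ⊗[k] BarC k B c)) ⧸ barT3Rel k B a b c

variable (k) in
/-- The class of a simple tensor in `P_a ⊗_A P_b ⊗_A P_c`. -/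
def mk3 (B : LeftBialgebroid k A U) (a b c : ℕ) (x : BarC k B a) (y : BarC k B b)
    (z : BarC k B c) : BarT3 k B a b c := Submodule.Quotient.mk (x ⊗ₜ[k] (y ⊗ₜ[k] z))

variable (k) in
/-- The bar differential `b'` and the components `Δ^P_{n i}` of the coproduct on the
bar resolution, given by their values on generators. -/
structure BarOps (B : LeftBialgebroid k A U) where
  bbar : ∀ n : ℕ, BarC k B (n + 1) →ₗ[k] BarC k B n
  bbar_gen : ∀ (n : ℕ) (u : ℕ → U),
      bbar n (bgenC k B (n + 1) u)
        = (∑ i ∈ Finset.range (n + 1), ((-1 : ℤ) ^ i) •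
            bgenC k B n
              (fun l => if l < i then u l else if l = i then u i * u (i + 1) else u (l + 1)))
          + ((-1 : ℤ) ^ (n + 1)) •
            bgenC k B n
              (fun l => if l = n then u n * B.tgt (B.counit (u (n + 1))) else u l)
  compP : ∀ (n i : ℕ), BarC k B n →ₗ[k] BarT k B i (n - i)
  compP_gen : ∀ (n i : ℕ), i ≤ n → ∀ u : ℕ → U,
      compP n i (bgenC k B n u)
        = ∑ j : (∀ l : Fin (i + 1), Fin ((B.comul (u l.val)).length)),
            mkT k B i (n - i)
              (bgenC k B i
                (fun l => if h : l < i + 1 then ((B.comul (u l)).get (j ⟨l, h⟩)).1 else u l))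
              (bgenC k B (n - i)
                (fun l => if l = 0 then
                    (List.ofFn fun r : Fin (i + 1) => ((B.comul (u r.val)).get (j r)).2).prod
                  else u (l + i)))

end BarResolution

section Statement5

variable {k : Type u} [CommRing k] {A U : Type u} [Ring A] [Algebra k A] [Ring U] [Algebra k U]

variable (k) in
/-- Simultaneous Sweedler first components of a tuple, for a given choice of
representatives. -/
def swFst (B : LeftBialgebroid k A U) (u : ℕ → U) {m : ℕ}
    (e : ∀ l : Fin m, Fin ((B.comul (u l.val)).length)) : ℕ → U :=
  fun l => if h : l < m then ((B.comul (u l)).get (e ⟨l, h⟩)).1 else u l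

variable (k) in
/-- The ordered product of the Sweedler second components of a tuple. -/
def swSndProd (B : LeftBialgebroid k A U) (u : ℕ → U) {m : ℕ}
    (e : ∀ l : Fin m, Fin ((B.comul (u l.val)).length)) : U :=
  (List.ofFn fun r : Fin m => ((B.comul (u r.val)).get (e r)).2).prod

section BarHelpers

variable {k : Type u} [CommRing k] {A U : Type u} [Ring A] [Algebra k A] [Ring U] [Algebra k U]
variable {M N L M' : Type u} [AddCommGroup M] [Module k M] [AddCommGroup N] [Module k N]
  [AddCommGroup L] [Module k L] [AddCommGroup M'] [Module k M']

/-- Relators of `M ⊗_A N` for two left `U`-modules. -/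
def tRel (B : LeftBialgebroid k A U) (ρ : U →ₐ[k] Module.End k M) (σ : U →ₐ[k] Module.End k N) :
    Submodule k (M ⊗[k] N) :=
  Submodule.span k {z | ∃ (a : A) (m : M) (n : N),
    z = (ρ (B.tgt a) m) ⊗ₜ[k] n - m ⊗ₜ[k] (σ (B.src a) n)}

/-- The tensor product `M ⊗_A N` of left `U`-modules. -/
abbrev TT (B : LeftBialgebroid k A U) (ρ : U →ₐ[k] Module.End k M) (σ : U →ₐ[k] Module.End k N) :=
  (M ⊗[k] N) ⧸ tRel B ρ σ

variable (B : LeftBialgebroid k A U) (ρ : U →ₐ[k] Module.End k M) (σ : U →ₐ[k] Module.End k N)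
  (τ : U →ₐ[k] Module.End k L) (ρ' : U →ₐ[k] Module.End k M')

/-- The projection to `M ⊗_A N`. -/
def tq : M ⊗[k] N →ₗ[k] TT B ρ σ := (tRel B ρ σ).mkQ

lemma tq_bal (a : A) (m : M) (n : N) :
    tq B ρ σ (ρ (B.tgt a) m ⊗ₜ[k] n) = tq B ρ σ (m ⊗ₜ[k] σ (B.src a) n) := by
  rw [← sub_eq_zero, ← map_sub]
  exact (Submodule.Quotient.mk_eq_zero _).2 (Submodule.subset_span ⟨a, m, n, rfl⟩)

/-- Universal property of `M ⊗_A N`. -/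
def tlift (f : M ⊗[k] N →ₗ[k] L)
    (h : ∀ (a : A) (m : M) (n : N), f (ρ (B.tgt a) m ⊗ₜ[k] n) = f (m ⊗ₜ[k] σ (B.src a) n)) :
    TT B ρ σ →ₗ[k] L :=
  (tRel B ρ σ).liftQ f (by
    refine Submodule.span_le.2 ?_
    rintro z ⟨a, m, n, rfl⟩
    simp [h a m n])

lemma tlift_tq (f : M ⊗[k] N →ₗ[k] L) (h) (z : M ⊗[k] N) :
    tlift B ρ σ f h (tq B ρ σ z) = f z := rfl

lemma tt_ext {f g : TT B ρ σ →ₗ[k] L}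
    (h : ∀ m n, f (tq B ρ σ (m ⊗ₜ[k] n)) = g (tq B ρ σ (m ⊗ₜ[k] n))) : f = g := by
  apply Submodule.linearMap_qext
  exact TensorProduct.ext' h

lemma list_sum_apply {X : Type*} (l : List X) (f : X → (M →ₗ[k] L)) (m : M) :
    (l.map f).sum m = (l.map fun x => f x m).sum := by
  induction l with
  | nil => simp
  | cons x l ih => simp [ih]

lemma map_list_sum' {X Y Z F : Type*} [AddCommMonoid Y] [AddCommMonoid Z] [FunLike F Y Z]
    [AddMonoidHomClass F Y Z] (g : F) (l : List X) (f : X → Y) :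
    g (l.map f).sum = (l.map fun x => g (f x)).sum := by
  induction l with
  | nil => simp
  | cons x l ih => simp [ih]

/-- evaluation `x ⊗ y ↦ x m ⊗ y n`. -/
def tev (m : M) (n : N) : U ⊗[k] U →ₗ[k] TT B ρ σ :=
  tq B ρ σ ∘ₗ TensorProduct.map (ρ.toLinearMap.flip m) (σ.toLinearMap.flip n)

lemma tev_tmul (m : M) (n : N) (x y : U) :
    tev B ρ σ m n (x ⊗ₜ[k] y) = tq B ρ σ (ρ x m ⊗ₜ[k] σ y n) := rfl

lemma tev_mid (m : M) (n : N) (z : U ⊗[k] U) (hz : z ∈ midSpan k A (B.src ·) (B.tgt ·)) :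
    tev B ρ σ m n z = 0 := by
  have : midSpan k A (B.src ·) (B.tgt ·) ≤ LinearMap.ker (tev B ρ σ m n) := by
    refine Submodule.span_le.2 ?_
    rintro z ⟨x, y, c, rfl⟩
    simp only [SetLike.mem_coe, LinearMap.mem_ker, map_sub, tev_tmul, map_mul,
      Module.End.mul_apply, tq_bal, sub_self]
  exact this hz

lemma tev_listTens (m : M) (n : N) (l : List (U × U)) :
    tev B ρ σ m n (listTens k U l) = (l.map fun p => tq B ρ σ (ρ p.1 m ⊗ₜ[k] σ p.2 n)).sum := by
  unfold listTens
  rw [map_list_sum']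
  rfl

/-- The action of a Sweedler list on `M ⊗ N`. -/
def dpre (u : U) : M ⊗[k] N →ₗ[k] M ⊗[k] N :=
  ((B.comul u).map fun p => TensorProduct.map (ρ p.1) (σ p.2)).sum

lemma dpre_apply (u : U) (z : M ⊗[k] N) :
    dpre B ρ σ u z = ((B.comul u).map fun p => TensorProduct.map (ρ p.1) (σ p.2) z).sum := by
  unfold dpre
  rw [list_sum_apply]

lemma tq_dpre (u : U) (m : M) (n : N) :
    tq B ρ σ (dpre B ρ σ u (m ⊗ₜ[k] n)) = tev B ρ σ m n (listTens k U (B.comul u)) := by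
  rw [dpre_apply, map_list_sum', tev_listTens]
  rfl

/-- The diagonal action of `u` on `M ⊗_A N`. -/
def dact0 (u : U) : TT B ρ σ →ₗ[k] TT B ρ σ :=
  tlift B ρ σ (tq B ρ σ ∘ₗ dpre B ρ σ u) (by
    intro a m n
    have h := tev_mid B ρ σ m n _ (B.comul_takeuchi u a)
    rw [map_sub, sub_eq_zero, tev_listTens, tev_listTens] at h
    simp only [LinearMap.comp_apply, dpre_apply, map_list_sum', TensorProduct.map_tmul]
    simpa [List.map_map, Function.comp_def, map_mul] using h)

lemma dact0_tq (u : U) (z : M ⊗[k] N) :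
    dact0 B ρ σ u (tq B ρ σ z) = tq B ρ σ (dpre B ρ σ u z) := rfl

lemma dact0_tmul (u : U) (m : M) (n : N) :
    dact0 B ρ σ u (tq B ρ σ (m ⊗ₜ[k] n)) = tev B ρ σ m n (listTens k U (B.comul u)) :=
  tq_dpre B ρ σ u m n

/-- The diagonal action as a `U`-module structure on `M ⊗_A N`. -/
def dact : U →ₐ[k] Module.End k (TT B ρ σ) :=
  AlgHom.ofLinearMap
    { toFun := dact0 B ρ σ
      map_add' := fun x y => tt_ext B ρ σ fun m n => by
        have h := tev_mid B ρ σ m n _ (B.comul_add x y)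
        rw [map_sub, map_sub, sub_sub, sub_eq_zero] at h
        simpa only [LinearMap.add_apply, dact0_tmul] using h
      map_smul' := fun c x => tt_ext B ρ σ fun m n => by
        have h := tev_mid B ρ σ m n _ (B.comul_smul c x)
        rw [map_sub, sub_eq_zero, map_smul] at h
        simpa only [LinearMap.smul_apply, dact0_tmul, RingHom.id_apply] using h }
    (tt_ext B ρ σ fun m n => by
        have h := tev_mid B ρ σ m n _ B.comul_one
        rw [map_sub, sub_eq_zero] at h
        simp only [LinearMap.coe_mk, AddHom.coe_mk, dact0_tmul, Module.End.one_apply]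
        rw [h, tev_tmul]; simp)
    (fun x y => tt_ext B ρ σ fun m n => by
        have h := tev_mid B ρ σ m n _ (B.comul_mul x y)
        rw [map_sub, sub_eq_zero] at h
        simp only [LinearMap.coe_mk, AddHom.coe_mk, dact0_tmul, Module.End.mul_apply]
        rw [h, tev_listTens, map_list_sum', map_list_sum']
        simp only [map_list_sum', tev_tmul, dact0_tmul, tev_listTens, map_mul,
          Module.End.mul_apply]
        generalize B.comul x = l
        generalize B.comul y = l'
        induction l' with
        | nil => simp
        | cons q l' ih => simp [List.sum_map_add, ih])

lemma dact_tq (u : U) (z : M ⊗[k] N) :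
    dact B ρ σ u (tq B ρ σ z) = tq B ρ σ (dpre B ρ σ u z) := rfl

lemma dact_tmul (u : U) (m : M) (n : N) :
    dact B ρ σ u (tq B ρ σ (m ⊗ₜ[k] n))
      = ((B.comul u).map fun p => tq B ρ σ (ρ p.1 m ⊗ₜ[k] σ p.2 n)).sum := by
  rw [← tev_listTens]; exact dact0_tmul B ρ σ u m n

lemma dact_tmul' (u : U) (m : M) (n : N) :
    dact B ρ σ u (tq B ρ σ (m ⊗ₜ[k] n)) = tev B ρ σ m n (listTens k U (B.comul u)) :=
  dact0_tmul B ρ σ u m n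

lemma dact_tgt (b : A) (m : M) (n : N) :
    dact B ρ σ (B.tgt b) (tq B ρ σ (m ⊗ₜ[k] n)) = tq B ρ σ (m ⊗ₜ[k] σ (B.tgt b) n) := by
  have h := tev_mid B ρ σ m n _ (B.comul_bimod 1 b 1)
  rw [map_sub, sub_eq_zero, mul_one, map_one, one_mul, ← dact_tmul'] at h
  rw [h]
  let R : TT B ρ σ →ₗ[k] TT B ρ σ :=
    tlift B ρ σ (tq B ρ σ ∘ₗ TensorProduct.map LinearMap.id (σ (B.tgt b))) (by
      intro a m n
      simp only [LinearMap.comp_apply, TensorProduct.map_tmul, LinearMap.id_apply, tq_bal]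
      rw [← Module.End.mul_apply, ← Module.End.mul_apply, ← map_mul, ← map_mul, B.src_tgt_comm])
  have h3 : R (dact B ρ σ 1 (tq B ρ σ (m ⊗ₜ[k] n))) = tq B ρ σ (m ⊗ₜ[k] σ (B.tgt b) n) := by
    rw [map_one, Module.End.one_apply]; rfl
  rw [dact_tmul, map_list_sum'] at h3
  rw [tev_listTens, List.map_map, ← h3]
  congr 1
  refine List.map_congr_left fun p _ => ?_
  simp only [Function.comp_apply, one_mul, map_mul, Module.End.mul_apply]
  rfl

lemma dact_src (a : A) (m : M) (n : N) :
    dact B ρ σ (B.src a) (tq B ρ σ (m ⊗ₜ[k] n)) = tq B ρ σ (ρ (B.src a) m ⊗ₜ[k] n) := by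
  have h := tev_mid B ρ σ m n _ (B.comul_bimod a 1 1)
  rw [map_sub, sub_eq_zero, mul_one, B.tgt_one, mul_one, ← dact_tmul'] at h
  rw [h]
  let R : TT B ρ σ →ₗ[k] TT B ρ σ :=
    tlift B ρ σ (tq B ρ σ ∘ₗ TensorProduct.map (ρ (B.src a)) LinearMap.id) (by
      intro c m n
      simp only [LinearMap.comp_apply, TensorProduct.map_tmul, LinearMap.id_apply, ← tq_bal]
      rw [← Module.End.mul_apply, ← Module.End.mul_apply, ← map_mul, ← map_mul, B.src_tgt_comm])
  have h3 : R (dact B ρ σ 1 (tq B ρ σ (m ⊗ₜ[k] n))) = tq B ρ σ (ρ (B.src a) m ⊗ₜ[k] n) := by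
    rw [map_one, Module.End.one_apply]; rfl
  rw [dact_tmul, map_list_sum'] at h3
  rw [tev_listTens, List.map_map, ← h3]
  congr 1
  refine List.map_congr_left fun p _ => ?_
  simp only [Function.comp_apply, one_mul, map_mul, Module.End.mul_apply]
  rfl

/-- functoriality in the left factor -/
def tmapL (f : M →ₗ[k] M') (hf : ∀ a m, f (ρ (B.tgt a) m) = ρ' (B.tgt a) (f m)) :
    TT B ρ σ →ₗ[k] TT B ρ' σ :=
  tlift B ρ σ (tq B ρ' σ ∘ₗ TensorProduct.map f LinearMap.id) (by
    intro a m n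
    simp [hf, tq_bal])

lemma tmapL_tq (f : M →ₗ[k] M') (hf) (z : M ⊗[k] N) :
    tmapL B ρ σ ρ' f hf (tq B ρ σ z) = tq B ρ' σ (TensorProduct.map f LinearMap.id z) := rfl


set_option linter.unusedSectionVars false

/-- The projection to `M ⊗_A N ⊗_A L`. -/
def tq3 : M ⊗[k] (N ⊗[k] L) →ₗ[k] TT B ρ (dact B σ τ) :=
  tq B ρ (dact B σ τ) ∘ₗ TensorProduct.map LinearMap.id (tq B σ τ)

lemma tq3_tmul (m : M) (z : N ⊗[k] L) :
    tq3 B ρ σ τ (m ⊗ₜ[k] z) = tq B ρ (dact B σ τ) (m ⊗ₜ[k] tq B σ τ z) := rfl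

/-- evaluation on triple tensors -/
def tev3 (m : M) (n : N) (l : L) : U ⊗[k] (U ⊗[k] U) →ₗ[k] TT B ρ (dact B σ τ) :=
  tq3 B ρ σ τ ∘ₗ TensorProduct.map (ρ.toLinearMap.flip m)
    (TensorProduct.map (σ.toLinearMap.flip n) (τ.toLinearMap.flip l))

lemma tev3_tmul (m : M) (n : N) (l : L) (x y z : U) :
    tev3 B ρ σ τ m n l (x ⊗ₜ[k] (y ⊗ₜ[k] z))
      = tq B ρ (dact B σ τ) (ρ x m ⊗ₜ[k] tq B σ τ (σ y n ⊗ₜ[k] τ z l)) := rfl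

lemma tev3_mid (m : M) (n : N) (l : L) (z : U ⊗[k] (U ⊗[k] U))
    (hz : z ∈ midSpan3 k A (B.src ·) (B.tgt ·)) : tev3 B ρ σ τ m n l z = 0 := by
  have : midSpan3 k A (B.src ·) (B.tgt ·) ≤ LinearMap.ker (tev3 B ρ σ τ m n l) := by
    refine Submodule.span_le.2 ?_
    rintro z (⟨x, y, w, c, rfl⟩ | ⟨x, y, w, c, rfl⟩)
    · simp only [SetLike.mem_coe, LinearMap.mem_ker, map_sub, tev3_tmul, map_mul,
        Module.End.mul_apply, tq_bal, dact_src, sub_self]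
    · simp only [SetLike.mem_coe, LinearMap.mem_ker, map_sub, tev3_tmul, map_mul,
        Module.End.mul_apply, tq_bal, sub_self]
  exact this hz

/-- The action `(Δ ⊗ 1) Δ` on triple tensors. -/
def d3 (u : U) : M ⊗[k] (N ⊗[k] L) →ₗ[k] M ⊗[k] (N ⊗[k] L) :=
  ((B.comul u).map fun p => ((B.comul p.1).map fun q =>
    TensorProduct.map (ρ q.1) (TensorProduct.map (σ q.2) (τ p.2))).sum).sum

lemma d3_apply (u : U) (z : M ⊗[k] (N ⊗[k] L)) :
    d3 B ρ σ τ u z = ((B.comul u).map fun p => ((B.comul p.1).map fun q =>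
      TensorProduct.map (ρ q.1) (TensorProduct.map (σ q.2) (τ p.2)) z).sum).sum := by
  unfold d3
  simp only [list_sum_apply]

lemma tq3_d3 (u : U) (z : M ⊗[k] (N ⊗[k] L)) :
    tq3 B ρ σ τ (d3 B ρ σ τ u z) = dact B ρ (dact B σ τ) u (tq3 B ρ σ τ z) := by
  have : tq3 B ρ σ τ ∘ₗ d3 B ρ σ τ u = dact B ρ (dact B σ τ) u ∘ₗ tq3 B ρ σ τ := by
    ext m n l
    have h := tev3_mid B ρ σ τ m n l _ (B.comul_coassoc u)
    rw [map_sub, sub_eq_zero] at h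
    simp only [map_list_sum', tev3_tmul] at h
    simp only [TensorProduct.AlgebraTensorModule.curry_apply, TensorProduct.curry_apply,
      LinearMap.comp_apply, d3_apply, map_list_sum',
      TensorProduct.map_tmul, tq3_tmul, dact_tmul, LinearMap.restrictScalars_self]
    rw [h]
    congr 1
    refine List.map_congr_left fun p _ => ?_
    generalize B.comul p.2 = l
    induction l with
    | nil => simp
    | cons q l' ih => simp [TensorProduct.tmul_add, ih]
  exact LinearMap.congr_fun this z

/-- shift of a sequence -/
def shf (u : ℕ → U) : ℕ → U := fun l => u (l + 1)

/-- cons of a sequence -/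
def scons (x : U) (v : ℕ → U) : ℕ → U
  | 0 => x
  | l + 1 => v l

lemma scons_shf (u : ℕ → U) : scons (u 0) (shf u) = u := by
  funext l; cases l <;> rfl

lemma shf_scons (x : U) (u : ℕ → U) : shf (scons x u) = u := rfl

/-- Iterated Sweedler sums. -/
def sw {X : Type*} [AddCommMonoid X] : ℕ → (ℕ → U) → ((ℕ → U) → U → X) → X
  | 0, u, F => F u 1
  | m + 1, u, F => ((B.comul (u 0)).map fun p =>
      sw m (shf u) (fun v y => F (scons p.1 v) (p.2 * y))).sum

lemma sum_get {X Y : Type*} [AddCommMonoid X] (l : List Y) (f : Y → X) :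
    ∑ i : Fin l.length, f (l.get i) = (l.map f).sum := by
  simp

lemma sum_sw {X : Type*} [AddCommMonoid X] (m : ℕ) (u : ℕ → U) (F : (ℕ → U) → U → X) :
    ∑ e : (∀ l : Fin m, Fin ((B.comul (u l.val)).length)),
      F (swFst k B u e) (swSndProd k B u e) = sw B m u F := by
  induction m generalizing u F with
  | zero =>
    rw [Fintype.sum_unique]
    simp [sw, swSndProd]
    rfl
  | succ m ih =>
    rw [sw, ← sum_get]
    simp only [← ih]
    rw [← Fintype.sum_prod_type' (f := fun (c : Fin (B.comul (u 0)).length)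
      (e : ∀ l : Fin m, Fin ((B.comul (shf u l.val)).length)) =>
      F (scons ((B.comul (u 0)).get c).1 (swFst k B (shf u) e))
        (((B.comul (u 0)).get c).2 * swSndProd k B (shf u) e))]
    refine (Fintype.sum_equiv
      (Fin.consEquiv (fun l : Fin (m+1) => Fin ((B.comul (u l.val)).length))) _ _ ?_).symm
    rintro ⟨c, e⟩
    congr 1
    · funext l
      cases l with
      | zero =>
        simp only [scons, swFst]
        rw [dif_pos (by omega : 0 < m + 1)]
        rfl
      | succ l =>
        simp only [scons, swFst, Fin.consEquiv]
        by_cases h : l < m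
        · rw [dif_pos h, dif_pos (by omega : l + 1 < m + 1)]
          rfl
        · rw [dif_neg h, dif_neg (by omega : ¬ (l + 1 < m + 1))]
          rfl
    · unfold swSndProd
      rw [List.ofFn_succ, List.prod_cons]
      rfl

lemma map_sw {X Y F : Type*} [AddCommMonoid X] [AddCommMonoid Y] [FunLike F X Y]
    [AddMonoidHomClass F X Y] (g : F) (m : ℕ) (u : ℕ → U) (f : (ℕ → U) → U → X) :
    g (sw B m u f) = sw B m u (fun v y => g (f v y)) := by
  induction m generalizing u f with
  | zero => rfl
  | succ m ih =>
    simp only [sw, map_list_sum', ih]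

/-- Iterated Sweedler sums in `M ⊗_A N`. -/
def SS (m : ℕ) (F : (ℕ → U) → M) (u : ℕ → U) (n : N) : TT B ρ σ :=
  tq B ρ σ (sw B m u (fun v y => F v ⊗ₜ[k] σ y n))

lemma SS_zero (F : (ℕ → U) → M) (u : ℕ → U) (n : N) :
    SS B ρ σ 0 F u n = tq B ρ σ (F u ⊗ₜ[k] n) := by
  simp [SS, sw]

lemma SS_succ (m : ℕ) (F G : (ℕ → U) → M) (hF : ∀ x v, F (scons x v) = ρ x (G v))
    (u : ℕ → U) (n : N) :
    SS B ρ σ (m + 1) F u n = dact B ρ σ (u 0) (SS B ρ σ m G (shf u) n) := by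
  unfold SS
  rw [dact_tq, dpre_apply, sw]
  simp only [map_sw, TensorProduct.map_tmul, hF, map_mul, Module.End.mul_apply]

lemma SS_map (f : M →ₗ[k] M') (hf) (m : ℕ) (F : (ℕ → U) → M) (u : ℕ → U) (n : N) :
    SS B ρ' σ m (fun v => f (F v)) u n = tmapL B ρ σ ρ' f hf (SS B ρ σ m F u n) := by
  unfold SS
  rw [tmapL_tq]
  simp only [map_sw, TensorProduct.map_tmul, LinearMap.id_apply]

/-- classes of generators of the bar complex -/
def cg (n : ℕ) (m : U) (u : ℕ → U) : BarC k B n := Submodule.Quotient.mk (freeGen k U m u)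

lemma cg_bgen (n : ℕ) (m : U) (u : ℕ → U) : cg B n m u = bgenC k B n (scons m u) := rfl

lemma bgen_cg (n : ℕ) (u : ℕ → U) : bgenC k B n u = cg B n (u 0) (shf u) := rfl

lemma cg_congr {n : ℕ} (m : U) {u v : ℕ → U} (h : ∀ i < n, u i = v i) :
    cg B n m u = cg B n m v := by
  refine (Submodule.Quotient.eq _).2 (Submodule.subset_span ?_)
  exact Or.inl (Or.inl (Or.inl (Or.inl (Or.inl (Or.inl ⟨m, u, v, h, rfl⟩)))))

lemma cg_add (n : ℕ) (m m' : U) (u : ℕ → U) :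
    cg B n (m + m') u = cg B n m u + cg B n m' u := by
  rw [← sub_eq_zero, ← sub_sub]
  refine (Submodule.Quotient.mk_eq_zero _).2 (Submodule.subset_span ?_)
  exact Or.inl (Or.inl (Or.inl (Or.inl (Or.inl (Or.inr ⟨m, m', u, rfl⟩)))))

lemma cg_smul (n : ℕ) (c : k) (m : U) (u : ℕ → U) :
    cg B n (c • m) u = c • cg B n m u := by
  rw [← sub_eq_zero]
  refine (Submodule.Quotient.mk_eq_zero _).2 (Submodule.subset_span ?_)
  exact Or.inl (Or.inl (Or.inl (Or.inl (Or.inr ⟨c, m, u, rfl⟩))))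

lemma cg_upd_add {n i : ℕ} (hi : i < n) (m : U) (u : ℕ → U) (y z : U) :
    cg B n m (update u i (y + z)) = cg B n m (update u i y) + cg B n m (update u i z) := by
  rw [← sub_eq_zero, ← sub_sub]
  refine (Submodule.Quotient.mk_eq_zero _).2 (Submodule.subset_span ?_)
  exact Or.inl (Or.inl (Or.inl (Or.inr ⟨m, u, i, hi, y, z, rfl⟩)))

lemma cg_upd_smul {n i : ℕ} (hi : i < n) (m : U) (u : ℕ → U) (c : k) (y : U) :
    cg B n m (update u i (c • y)) = c • cg B n m (update u i y) := by
  rw [← sub_eq_zero]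
  refine (Submodule.Quotient.mk_eq_zero _).2 (Submodule.subset_span ?_)
  exact Or.inl (Or.inl (Or.inr ⟨m, u, i, hi, c, y, rfl⟩))

lemma cg_bal0 {n : ℕ} (hn : 0 < n) (m : U) (u : ℕ → U) (a : A) :
    cg B n (m * B.tgt a) u = cg B n m (update u 0 (B.tgt a * u 0)) := by
  rw [← sub_eq_zero]
  refine (Submodule.Quotient.mk_eq_zero _).2 (Submodule.subset_span ?_)
  exact Or.inl (Or.inr ⟨m, u, a, hn, rfl⟩)

lemma cg_bal {n i : ℕ} (hi : i + 1 < n) (m : U) (u : ℕ → U) (a : A) :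
    cg B n m (update u i (u i * B.tgt a))
      = cg B n m (update u (i + 1) (B.tgt a * u (i + 1))) := by
  rw [← sub_eq_zero]
  refine (Submodule.Quotient.mk_eq_zero _).2 (Submodule.subset_span ?_)
  exact Or.inr ⟨m, u, a, i, hi, rfl⟩

lemma bar_ext {X : Type*} [AddCommGroup X] [Module k X] {n : ℕ} {f g : BarC k B n →ₗ[k] X}
    (h : ∀ u, f (bgenC k B n u) = g (bgenC k B n u)) : f = g := by
  apply Submodule.linearMap_qext
  refine Finsupp.lhom_ext' fun ⟨m, u⟩ => LinearMap.ext_ring ?_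
  exact h (scons m u)

/-- universal property of the bar modules -/
def blift {X : Type u} [AddCommGroup X] [Module k X] (n : ℕ) (g : U → (ℕ → U) → X)
    (h1 : ∀ m u v, (∀ i < n, u i = v i) → g m u = g m v)
    (h2 : ∀ m m' u, g (m + m') u = g m u + g m' u)
    (h3 : ∀ (c : k) m u, g (c • m) u = c • g m u)
    (h4 : ∀ m u i, i < n → ∀ y z, g m (update u i (y + z)) = g m (update u i y) + g m (update u i z))
    (h5 : ∀ m u i, i < n → ∀ (c : k) y, g m (update u i (c • y)) = c • g m (update u i y))
    (h6 : ∀ m u a, 0 < n → g (m * B.tgt a) u = g m (update u 0 (B.tgt a * u 0)))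
    (h7 : ∀ m u a i, i + 1 < n → g m (update u i (u i * B.tgt a))
      = g m (update u (i + 1) (B.tgt a * u (i + 1)))) : BarC k B n →ₗ[k] X :=
  (chainRel k B (barR B) n).liftQ (Finsupp.linearCombination k fun p : U × (ℕ → U) => g p.1 p.2) (by
    have e : ∀ m u, Finsupp.linearCombination k (fun p : U × (ℕ → U) => g p.1 p.2)
        (freeGen k U m u) = g m u := by
      intro m u; simp [freeGen]
    refine Submodule.span_le.2 ?_
    rintro z ((((((⟨m, u, v, h, rfl⟩ | ⟨m, m', u, rfl⟩) | ⟨c, m, u, rfl⟩) | ⟨m, u, i, hi, y, z, rfl⟩)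
      | ⟨m, u, i, hi, c, y, rfl⟩) | ⟨m, u, a, hn, rfl⟩) | ⟨m, u, a, i, hi, rfl⟩) <;>
      simp only [SetLike.mem_coe, LinearMap.mem_ker, map_sub, map_smul, e]
    · rw [h1 m u v h, sub_self]
    · rw [h2, sub_sub, sub_self]
    · rw [h3, sub_self]
    · rw [h4 m u i hi, sub_sub, sub_self]
    · rw [h5 m u i hi, sub_self]
    · rw [← h6 m u a hn, sub_eq_zero]; rfl
    · rw [h7 m u a i hi, sub_self])

lemma blift_cg {X : Type u} [AddCommGroup X] [Module k X] (n : ℕ) (g : U → (ℕ → U) → X)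
    (h1 h2 h3 h4 h5 h6 h7) (m : U) (u : ℕ → U) :
    blift B n g h1 h2 h3 h4 h5 h6 h7 (cg B n m u) = g m u := by
  have : blift B n g h1 h2 h3 h4 h5 h6 h7 (cg B n m u) =
    Finsupp.linearCombination k (fun p : U × (ℕ → U) => g p.1 p.2) (freeGen k U m u) := rfl
  rw [this]; simp [freeGen]

/-- left multiplication on the bar modules -/
def bact0 (n : ℕ) (x : U) : BarC k B n →ₗ[k] BarC k B n :=
  blift B n (fun m u => cg B n (x * m) u)
    (fun m u v h => cg_congr B _ h)
    (fun m m' u => by rw [mul_add, cg_add])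
    (fun c m u => by rw [mul_smul_comm, cg_smul])
    (fun m u i hi y z => cg_upd_add B hi _ u y z)
    (fun m u i hi c y => cg_upd_smul B hi _ u c y)
    (fun m u a hn => by rw [← mul_assoc, cg_bal0 B hn])
    (fun m u a i hi => cg_bal B hi _ u a)

lemma bact0_cg (n : ℕ) (x m : U) (u : ℕ → U) : bact0 B n x (cg B n m u) = cg B n (x * m) u :=
  blift_cg ..

/-- the left `U`-module structure on the bar modules -/
def bact (n : ℕ) : U →ₐ[k] Module.End k (BarC k B n) :=
  AlgHom.ofLinearMap
    { toFun := bact0 B n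
      map_add' := fun x y => bar_ext B fun u => by
        simp only [bgen_cg, bact0_cg, LinearMap.add_apply, add_mul, cg_add]
      map_smul' := fun c x => bar_ext B fun u => by
        simp only [bgen_cg, bact0_cg, LinearMap.smul_apply, smul_mul_assoc, cg_smul,
          RingHom.id_apply] }
    (bar_ext B fun u => by
        simp only [bgen_cg, LinearMap.coe_mk, AddHom.coe_mk, bact0_cg, one_mul,
          Module.End.one_apply])
    (fun x y => bar_ext B fun u => by
        simp only [bgen_cg, LinearMap.coe_mk, AddHom.coe_mk, bact0_cg, mul_assoc,
          Module.End.mul_apply])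

lemma bact_gen (n : ℕ) (x y : U) (v : ℕ → U) :
    bact B n x (bgenC k B n (scons y v)) = bgenC k B n (scons (x * y) v) :=
  bact0_cg B n x y v

lemma scons_update (m : U) (u : ℕ → U) (i : ℕ) (y : U) :
    scons m (update u i y) = update (scons m u) (i + 1) y := by
  funext l
  cases l with
  | zero => rfl
  | succ l => simp [scons, update_apply]

lemma scons_eq_update (m x : U) (u : ℕ → U) :
    scons m u = update (scons x u) 0 m := by
  funext l
  cases l with
  | zero => rfl
  | succ l => simp [scons, update_apply]

/-- insertion of a unit in front -/
def bins (n : ℕ) : BarC k B n →ₗ[k] BarC k B (n + 1) :=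
  blift B n (fun m u => cg B (n + 1) 1 (scons m u))
    (fun m u v h => cg_congr B _ (by
      rintro (_ | i) hi
      · rfl
      · exact h i (by omega)))
    (fun m m' u => by
      rw [scons_eq_update (m + m') 0, cg_upd_add B (by omega), ← scons_eq_update,
        ← scons_eq_update])
    (fun c m u => by
      rw [scons_eq_update (c • m) 0, cg_upd_smul B (by omega), ← scons_eq_update])
    (fun m u i hi y z => by
      simp only [scons_update]; exact cg_upd_add B (by omega) _ _ _ _)
    (fun m u i hi c y => by
      simp only [scons_update]; exact cg_upd_smul B (by omega) _ _ _ _)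
    (fun m u a hn => by
      rw [scons_update, scons_eq_update (m * B.tgt a) m]
      exact cg_bal B (i := 0) (by omega) 1 (scons m u) a)
    (fun m u a i hi => by
      rw [scons_update, scons_update]
      exact cg_bal B (i := i + 1) (by omega) 1 (scons m u) a)

lemma bins_gen (n : ℕ) (u : ℕ → U) :
    bins B n (bgenC k B n u) = bgenC k B (n + 1) (scons 1 u) := by
  have : bins B n (cg B n (u 0) (shf u)) = cg B (n + 1) 1 (scons (u 0) (shf u)) := blift_cg ..
  rw [scons_shf] at this
  exact this

lemma bgen_scons (n : ℕ) (x : U) (v : ℕ → U) :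
    bgenC k B (n + 1) (scons x v) = bact B (n + 1) x (bins B n (bgenC k B n v)) := by
  rw [bins_gen, bact_gen, mul_one]

lemma bgen_head (n : ℕ) (x : U) (v : ℕ → U) :
    bgenC k B n (scons x v) = bact B n x (bgenC k B n (scons 1 v)) := by
  rw [bact_gen, mul_one]

lemma bgen_congr {n : ℕ} {u v : ℕ → U} (h : ∀ i ≤ n, u i = v i) :
    bgenC k B n u = bgenC k B n v := by
  rw [bgen_cg, bgen_cg, h 0 (by omega)]
  exact cg_congr B _ fun i hi => h (i + 1) (by omega)

lemma bins_tgt (n : ℕ) (a : A) (x : BarC k B n) :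
    bins B n (bact B n (B.tgt a) x) = bact B (n + 1) (B.tgt a) (bins B n x) := by
  have : bins B n ∘ₗ bact B n (B.tgt a) = bact B (n + 1) (B.tgt a) ∘ₗ bins B n := by
    refine bar_ext B fun u => ?_
    rw [← scons_shf u]
    simp only [LinearMap.comp_apply, bact_gen, bins_gen, mul_one]
    have h := cg_bal0 B (n := n + 1) (by omega) 1 u a
    rw [one_mul, cg_bgen, cg_bgen] at h
    rw [scons_shf, h]
    congr 2
    rw [scons_eq_update _ (u 0), scons_shf]
  exact LinearMap.congr_fun this x

/-- `Σ (u⁰₍₁₎,…,u^i₍₁₎) ⊗ u⁰₍₂₎⋯u^i₍₂₎ n` -/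
def EE (i : ℕ) (u : ℕ → U) (n : N) : TT B (bact B i) σ :=
  SS B (bact B i) σ (i + 1) (bgenC k B i) u n

/-- `Σ (1, w⁰₍₁₎,…) ⊗ w⁰₍₂₎⋯ n` -/
def XX (i : ℕ) (w : ℕ → U) (n : N) : TT B (bact B i) σ :=
  SS B (bact B i) σ i (fun v => bgenC k B i (scons 1 v)) w n

/-- `ins ⊗ id` -/
def insT (i : ℕ) : TT B (bact B i) σ →ₗ[k] TT B (bact B (i + 1)) σ :=
  tmapL B (bact B i) σ (bact B (i + 1)) (bins B i) (bins_tgt B i)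

lemma EE_eq (i : ℕ) (u : ℕ → U) (n : N) :
    EE B σ i u n = dact B (bact B i) σ (u 0) (XX B σ i (shf u) n) :=
  SS_succ B _ σ i _ _ (fun x v => bgen_head B i x v) u n

lemma XX_succ (i : ℕ) (w : ℕ → U) (n : N) :
    XX B σ (i + 1) w n = insT B σ i (EE B σ i w n) := by
  unfold EE insT
  rw [← SS_map]
  unfold XX
  simp only [bins_gen]

lemma bgen_zero (x : U) (v w : ℕ → U) :
    bgenC k B 0 (scons x v) = bact B 0 x (bgenC k B 0 (scons 1 w)) := by
  rw [bact_gen, mul_one]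
  exact bgen_congr B (by rintro (_ | i) hi; · rfl
                         · omega)

lemma XX_zero (w w' : ℕ → U) (n : N) :
    XX B σ 0 w n = tq B (bact B 0) σ (bgenC k B 0 (scons 1 w') ⊗ₜ[k] n) := by
  unfold XX
  rw [SS_zero, bgen_zero B 1 w w', map_one, Module.End.one_apply]

lemma EE_succ (i : ℕ) (u : ℕ → U) (n : N) :
    EE B σ (i + 1) u n
      = dact B (bact B (i + 1)) σ (u 0) (insT B σ i (EE B σ i (shf u) n)) := by
  rw [EE_eq, XX_succ]

lemma EE_congr (i : ℕ) {u v : ℕ → U} (h : ∀ l ≤ i, u l = v l) (n : N) :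
    EE B σ i u n = EE B σ i v n := by
  induction i generalizing u v with
  | zero => rw [EE_eq, EE_eq, XX_zero B σ _ v, XX_zero B σ _ v, h 0 le_rfl]
  | succ i ih =>
    rw [EE_succ, EE_succ, h 0 (by omega), ih (u := shf u) (v := shf v)]
    exact fun l hl => h (l + 1) (by omega)

/-! the right counit -/

/-- `m ⊗ v ↦ t(ε v) m` -/
def theta : TT B ρ (Algebra.lmul k U) →ₗ[k] M :=
  tlift B ρ (Algebra.lmul k U)
    (TensorProduct.lift (ρ.toLinearMap ∘ₗ B.tgt ∘ₗ B.counit).flip) (by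
      intro a m n
      simp only [TensorProduct.lift.tmul, LinearMap.flip_apply, LinearMap.comp_apply,
        AlgHom.toLinearMap_apply, Algebra.coe_lmul_eq_mul, LinearMap.mul_apply',
        B.counit_lact, B.tgt_mul, map_mul, Module.End.mul_apply])

lemma theta_tmul (m : M) (v : U) :
    theta B ρ (tq B ρ (Algebra.lmul k U) (m ⊗ₜ[k] v)) = ρ (B.tgt (B.counit v)) m := rfl

lemma theta_dact (x : U) (z : TT B ρ (Algebra.lmul k U)) :
    theta B ρ (dact B ρ (Algebra.lmul k U) x z) = ρ x (theta B ρ z) := by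
  have : theta B ρ ∘ₗ dact B ρ (Algebra.lmul k U) x = ρ x ∘ₗ theta B ρ := by
    refine tt_ext B ρ _ fun m n => ?_
    simp only [LinearMap.comp_apply, theta_tmul]
    -- reduce `n` to `s(ε n)` and use the balancing
    have e1 : theta B ρ (dact B ρ (Algebra.lmul k U) x (tq B ρ (Algebra.lmul k U) (m ⊗ₜ[k] n)))
        = theta B ρ (dact B ρ (Algebra.lmul k U) x (tq B ρ (Algebra.lmul k U)
          (m ⊗ₜ[k] (B.src (B.counit n) * 1)))) := by
      simp only [dact_tmul, map_list_sum', theta_tmul, Algebra.coe_lmul_eq_mul,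
        LinearMap.mul_apply', mul_one]
      congr 1
      refine List.map_congr_left fun p _ => ?_
      rw [B.counit_mul_src]
    have e2 := tq_bal B ρ (Algebra.lmul k U) (B.counit n) m 1
    rw [e1]
    have e3 : (Algebra.lmul k U) (B.src (B.counit n)) 1 = B.src (B.counit n) * 1 := rfl
    rw [← e3, ← e2, dact_tmul, map_list_sum']
    simp only [theta_tmul, Algebra.coe_lmul_eq_mul, LinearMap.mul_apply', mul_one]
    have h := congrArg (fun y => ρ y (ρ (B.tgt (B.counit n)) m)) (B.comul_counit_right x)
    simp only [map_list_sum', list_sum_apply, map_mul, Module.End.mul_apply] at h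
    exact h
  exact LinearMap.congr_fun this z

lemma theta_ins (i : ℕ) (z : TT B (bact B i) (Algebra.lmul k U)) :
    theta B (bact B (i + 1)) (insT B _ i z) = bins B i (theta B (bact B i) z) := by
  have : theta B (bact B (i + 1)) ∘ₗ (insT B _ i) = bins B i ∘ₗ (theta B (bact B i)) := by
    refine tt_ext B _ _ fun m n => ?_
    simp only [LinearMap.comp_apply, theta_tmul, bins_tgt]
    rfl
  exact LinearMap.congr_fun this z

lemma theta_EE (i : ℕ) (u : ℕ → U) :
    theta B (bact B i) (EE B (Algebra.lmul k U) i u 1) = bgenC k B i u := by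
  induction i generalizing u with
  | zero =>
    rw [EE_eq, theta_dact, XX_zero B _ _ (shf u), theta_tmul, B.counit_one, B.tgt_one, map_one,
      Module.End.one_apply, ← bgen_head, scons_shf]
  | succ i ih =>
    rw [EE_succ, theta_dact, theta_ins, ih, ← bgen_scons, scons_shf]

/-! coassociativity -/

lemma sw_list {X Y : Type*} [AddCommMonoid X] (m : ℕ) (u : ℕ → U) (l : List Y)
    (H : Y → (ℕ → U) → U → X) :
    sw B m u (fun v y => (l.map fun q => H q v y).sum) = (l.map fun q => sw B m u (H q)).sum := by
  induction m generalizing u H with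
  | zero => rfl
  | succ m ih =>
    simp only [sw, ih]
    generalize B.comul (u 0) = l'
    induction l' with
    | nil => simp
    | cons p l' ih' => simp [List.sum_map_add, ih']

/-- the left-hand side of coassociativity -/
def LL (a b : ℕ) (u : ℕ → U) (t : L) : BarC k B a ⊗[k] (BarC k B b ⊗[k] L) :=
  sw B (a + b + 1) u (fun v y => sw B (a + 1) v (fun v' y' =>
    bgenC k B a v' ⊗ₜ[k] (bgenC k B b (scons y' (fun l => v (l + 1 + a))) ⊗ₜ[k] τ y t)))

lemma LL_zero (b : ℕ) (u : ℕ → U) (t : L) :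
    LL B τ 0 b u t = d3 B (bact B 0) (bact B b) τ (u 0)
      (bgenC k B 0 (scons 1 (shf u)) ⊗ₜ[k]
        sw B b (shf u) (fun v y => bgenC k B b (scons 1 v) ⊗ₜ[k] τ y t)) := by
  unfold LL
  rw [zero_add, d3_apply, sw]
  congr 1
  refine List.map_congr_left fun p _ => ?_
  simp only [TensorProduct.map_tmul, map_sw]
  have : ∀ q : U × U, (bact B 0 q.1 (bgenC k B 0 (scons 1 (shf u)))) ⊗ₜ[k]
      sw B b (shf u) (fun v y => bact B b q.2 (bgenC k B b (scons 1 v)) ⊗ₜ[k] τ p.2 (τ y t))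
      = sw B b (shf u) (fun v y => bgenC k B 0 (scons q.1 v) ⊗ₜ[k]
        (bgenC k B b (scons (q.2 * 1) v) ⊗ₜ[k] τ (p.2 * y) t)) := by
    intro q
    have h := map_sw B (TensorProduct.mk k _ (BarC k B b ⊗[k] L)
      (bact B 0 q.1 (bgenC k B 0 (scons 1 (shf u))))) b (shf u)
      (fun v y => bact B b q.2 (bgenC k B b (scons 1 v)) ⊗ₜ[k] τ p.2 (τ y t))
    rw [TensorProduct.mk_apply] at h
    rw [h]
    simp only [TensorProduct.mk_apply, bact_gen, map_mul, Module.End.mul_apply]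
    congr 1
    funext v y
    rw [bgen_zero B q.1 v (shf u), bact_gen]
  simp only [this]
  rw [← sw_list]
  rfl

lemma LL_succ (a b : ℕ) (u : ℕ → U) (t : L) :
    LL B τ (a + 1) b u t = d3 B (bact B (a + 1)) (bact B b) τ (u 0)
      (TensorProduct.map (bins B a) LinearMap.id (LL B τ a b (shf u) t)) := by
  unfold LL
  rw [show a + 1 + b + 1 = (a + b + 1) + 1 by omega, d3_apply, sw]
  congr 1
  refine List.map_congr_left fun p _ => ?_
  simp only [TensorProduct.map_tmul, map_sw, ← bgen_scons, LinearMap.id_apply, bact_gen]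
  rw [← sw_list]
  congr 1
  funext v y
  rw [sw]
  simp only [map_mul, Module.End.mul_apply]
  rfl

lemma XX_def (i : ℕ) (w : ℕ → U) (n : N) :
    XX B σ i w n = tq B (bact B i) σ
      (sw B i w (fun v y => bgenC k B i (scons 1 v) ⊗ₜ[k] σ y n)) := by
  unfold XX SS
  rfl

lemma EE_one (b : ℕ) (w : ℕ → U) (t : L) :
    EE B τ b (scons 1 w) t = XX B τ b w t := by
  rw [EE_eq, shf_scons, scons, map_one, Module.End.one_apply]

lemma insT_tq (i : ℕ) (z : BarC k B i ⊗[k] N) :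
    insT B σ i (tq B (bact B i) σ z)
      = tq B (bact B (i + 1)) σ (TensorProduct.map (bins B i) LinearMap.id z) := by
  unfold insT
  rw [tmapL_tq]

lemma tq3_ins (a b : ℕ) (z : BarC k B a ⊗[k] (BarC k B b ⊗[k] L)) :
    tq3 B (bact B (a + 1)) (bact B b) τ (TensorProduct.map (bins B a) LinearMap.id z)
        = insT B _ a (tq3 B (bact B a) (bact B b) τ z) := by
  have : tq3 B (bact B (a + 1)) (bact B b) τ ∘ₗ (TensorProduct.map (bins B a) LinearMap.id)
        = insT B _ a ∘ₗ (tq3 B (bact B a) (bact B b) τ) := by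
    refine TensorProduct.ext' fun x y => ?_
    rw [LinearMap.comp_apply, LinearMap.comp_apply, TensorProduct.map_tmul, tq3_tmul, tq3_tmul,
      insT_tq, TensorProduct.map_tmul, LinearMap.id_apply, LinearMap.id_apply]
  exact LinearMap.congr_fun this z

lemma tq3_LL (a b : ℕ) (u : ℕ → U) (t : L) :
    tq3 B (bact B a) (bact B b) τ (LL B τ a b u t)
      = EE B (dact B (bact B b) τ) a u (XX B τ b (fun r => u (r + 1 + a)) t) := by
  induction a generalizing u with
  | zero =>
    rw [LL_zero, tq3_d3, tq3_tmul, EE_eq, XX_zero B _ _ (shf u), XX_def]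
    congr 1
  | succ a ih =>
    rw [LL_succ, tq3_d3, EE_succ, tq3_ins, ih (shf u)]
    congr 1

/-- inner faces on sequences -/
def ds (s : ℕ) (v : ℕ → U) : ℕ → U :=
  fun l => if l < s then v l else if l = s then v s * v (s + 1) else v (l + 1)

/-- last face on sequences -/
def lst (n : ℕ) (v : ℕ → U) : ℕ → U :=
  fun l => if l = n then v n * B.tgt (B.counit (v (n + 1))) else v l

lemma ds_zero (x : U) (v : ℕ → U) : ds 0 (scons x v) = scons (x * v 0) (shf v) := by
  funext l
  cases l with
  | zero => simp [ds, scons]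
  | succ l => simp [ds, scons, shf]

lemma ds_succ (s : ℕ) (x : U) (v : ℕ → U) : ds (s + 1) (scons x v) = scons x (ds s v) := by
  funext l
  cases l with
  | zero => simp [ds, scons]
  | succ l => simp [ds, scons]

lemma lst_zero (x : U) (v : ℕ → U) :
    lst B 0 (scons x v) = scons (x * B.tgt (B.counit (v 0))) v := by
  funext l
  cases l with
  | zero => simp [lst, scons]
  | succ l => simp [lst, scons]

lemma lst_succ (n : ℕ) (x : U) (v : ℕ → U) :
    lst B (n + 1) (scons x v) = scons x (lst B n v) := by
  funext l
  cases l with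
  | zero => simp [lst, scons]
  | succ l => simp [lst, scons]

lemma bgen_ds (q s : ℕ) (y : U) (v : ℕ → U) :
    bgenC k B q (ds s (scons y v)) = bact B q y (bgenC k B q (ds s (scons 1 v))) := by
  cases s with
  | zero => rw [ds_zero, ds_zero, bact_gen, one_mul]
  | succ s => rw [ds_succ, ds_succ, bact_gen, mul_one]

lemma bgen_lst (q n : ℕ) (y : U) (v : ℕ → U) :
    bgenC k B q (lst B n (scons y v)) = bact B q y (bgenC k B q (lst B n (scons 1 v))) := by
  cases n with
  | zero => rw [lst_zero, lst_zero, bact_gen, one_mul]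
  | succ s => rw [lst_succ, lst_succ, bact_gen, mul_one]

lemma sw_add {X : Type*} [AddCommMonoid X] (m : ℕ) (u : ℕ → U) (f g : (ℕ → U) → U → X) :
    sw B m u (fun v y => f v y + g v y) = sw B m u f + sw B m u g := by
  have := sw_list B m u [f, g] (fun h => h)
  simpa using this

/-- `SS` as an additive map in the first factor -/
def SSh (m : ℕ) (u : ℕ → U) (n : N) : ((ℕ → U) → M) →+ TT B ρ σ :=
  AddMonoidHom.mk' (fun F => SS B ρ σ m F u n) (by
    intro F G
    simp only [SS, Pi.add_apply, TensorProduct.add_tmul, sw_add, map_add])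

lemma SSh_apply (m : ℕ) (u : ℕ → U) (n : N) (F : (ℕ → U) → M) :
    SSh B ρ σ m u n F = SS B ρ σ m F u n := rfl

/-- `SS` as an additive map in the second factor -/
def SSn (m : ℕ) (F : (ℕ → U) → M) (u : ℕ → U) : N →+ TT B ρ σ :=
  AddMonoidHom.mk' (fun n => SS B ρ σ m F u n) (by
    intro F G
    simp only [SS, map_add, TensorProduct.tmul_add, sw_add])

lemma SSn_apply (m : ℕ) (u : ℕ → U) (n : N) (F : (ℕ → U) → M) :
    SSn B ρ σ m F u n = SS B ρ σ m F u n := rfl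

lemma EE_ds (i s : ℕ) (hs : s ≤ i) (u : ℕ → U) (n : N) :
    EE B σ i (ds s u) n = SS B (bact B i) σ (i + 2) (fun v => bgenC k B i (ds s v)) u n := by
  induction s generalizing i u with
  | zero =>
    rw [SS_succ B _ σ (i + 1) _ (bgenC k B i)]
    · change _ = dact B (bact B i) σ (u 0) (EE B σ i (shf u) n)
      rw [EE_eq, EE_eq, ← Module.End.mul_apply, ← map_mul]
      conv_lhs => rw [← scons_shf u, ds_zero]
      rfl
    · intro x v
      rw [ds_zero, ← bact_gen, scons_shf]
  | succ s ih =>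
    obtain ⟨i, rfl⟩ : ∃ j, i = j + 1 := ⟨i - 1, by omega⟩
    rw [SS_succ B _ σ (i + 2) _ (fun v => bins B i (bgenC k B i (ds s v))),
      SS_map B (bact B i) σ (bact B (i + 1)) (bins B i) (bins_tgt B i), ← ih i (by omega),
      EE_succ]
    · conv_lhs => rw [← scons_shf u, ds_succ]
      rfl
    · intro x v
      rw [ds_succ, bgen_scons]

lemma EE_lst (i : ℕ) (u : ℕ → U) (n : N) :
    EE B σ i (lst B i u) n = EE B σ i u (σ (B.tgt (B.counit (u (i + 1)))) n) := by
  induction i generalizing u with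
  | zero =>
    rw [EE_eq, EE_eq, XX_zero B σ _ (shf u), XX_zero B σ _ (shf u), ← dact_tgt,
      ← Module.End.mul_apply, ← map_mul]
    rfl
  | succ i ih =>
    rw [EE_succ, EE_succ]
    conv_lhs => rw [← scons_shf u, lst_succ, shf_scons, ih]
    rfl

lemma SS_lst (i : ℕ) (u : ℕ → U) (n : N) :
    SS B (bact B i) σ (i + 2) (fun v => bgenC k B i (lst B i v)) u n
      = EE B σ i u (σ (u (i + 1)) n) := by
  induction i generalizing u with
  | zero =>
    rw [SS_succ B _ σ 1 _ (fun v => bact B 0 (B.tgt (B.counit (v 0)))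
      (bgenC k B 0 (scons 1 (shf u)))), EE_eq, XX_zero B σ _ (shf u)]
    · congr 1
      unfold SS
      simp only [sw, map_list_sum', mul_one, scons, tq_bal]
      have h := congrArg (fun y => tq B (bact B 0) σ
        (bgenC k B 0 (scons 1 (shf u)) ⊗ₜ[k] σ y n)) (B.comul_counit_left (shf u 0))
      refine Eq.trans ?_ h
      have h2 := map_list_sum' (tq B (bact B 0) σ ∘ₗ TensorProduct.mk k (BarC k B 0) N
        (bgenC k B 0 (scons 1 (shf u))) ∘ₗ (σ.toLinearMap.flip n)) (B.comul (shf u 0))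
        (fun p => B.src (B.counit p.1) * p.2)
      refine Eq.trans ?_ h2.symm
      congr 1
      refine List.map_congr_left fun p _ => ?_
      simp only [LinearMap.comp_apply, TensorProduct.mk_apply, LinearMap.flip_apply,
        AlgHom.toLinearMap_apply, map_mul, Module.End.mul_apply]
    · intro x v
      rw [lst_zero, bgen_zero B _ v (shf u), map_mul, Module.End.mul_apply]
  | succ i ih =>
    rw [SS_succ B _ σ (i + 2) _ (fun v => bins B i (bgenC k B i (lst B i v))),
      SS_map B (bact B i) σ (bact B (i + 1)) (bins B i) (bins_tgt B i), ih, EE_succ]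
    · rfl
    · intro x v
      rw [lst_succ, bgen_scons]

lemma bar_key (i q : ℕ) (u : ℕ → U) :
    (∑ s ∈ Finset.range (i + q + 1), ((-1 : ℤ) ^ s) •
        EE B (bact B q) i (ds s u) (bgenC k B q (scons 1 (fun l => ds s u (l + 1 + i)))))
      + ((-1 : ℤ) ^ (i + q + 1)) • EE B (bact B q) i (lst B (i + q) u)
          (bgenC k B q (scons 1 (fun l => lst B (i + q) u (l + 1 + i))))
    = ((∑ s ∈ Finset.range (i + 1), ((-1 : ℤ) ^ s) •
          SS B (bact B i) (bact B q) (i + 2) (fun v => bgenC k B i (ds s v)) u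
            (bgenC k B q (scons 1 (fun l => u (l + 1 + i + 1)))))
        + ((-1 : ℤ) ^ (i + 1)) •
          SS B (bact B i) (bact B q) (i + 2) (fun v => bgenC k B i (lst B i v)) u
            (bgenC k B q (scons 1 (fun l => u (l + 1 + i + 1)))))
      + ((-1 : ℤ) ^ i) • ((∑ s ∈ Finset.range (q + 1), ((-1 : ℤ) ^ s) •
          EE B (bact B q) i u (bgenC k B q (ds s (scons 1 (fun l => u (l + 1 + i))))))
        + ((-1 : ℤ) ^ (q + 1)) •
          EE B (bact B q) i u (bgenC k B q (lst B q (scons 1 (fun l => u (l + 1 + i)))))) := by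
  rw [show i + q + 1 = (i + 1) + q by omega, Finset.sum_range_add, Finset.sum_range_succ' _ q,
    SS_lst]
  have e1 : ∀ s ∈ Finset.range (i + 1), ((-1 : ℤ) ^ s) •
        EE B (bact B q) i (ds s u) (bgenC k B q (scons 1 (fun l => ds s u (l + 1 + i))))
      = ((-1 : ℤ) ^ s) •
          SS B (bact B i) (bact B q) (i + 2) (fun v => bgenC k B i (ds s v)) u
            (bgenC k B q (scons 1 (fun l => u (l + 1 + i + 1)))) := by
    intro s hs
    rw [Finset.mem_range] at hs
    rw [EE_ds B _ i s (by omega)]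
    congr 4
    funext l
    simp only [ds]
    rw [if_neg (by omega), if_neg (by omega)]
  have e2 : ∀ x ∈ Finset.range q, ((-1 : ℤ) ^ (i + 1 + x)) •
        EE B (bact B q) i (ds (i + 1 + x) u)
          (bgenC k B q (scons 1 (fun l => ds (i + 1 + x) u (l + 1 + i))))
      = ((-1 : ℤ) ^ i) • ((-1 : ℤ) ^ (x + 1)) • EE B (bact B q) i u
          (bgenC k B q (ds (x + 1) (scons 1 (fun l => u (l + 1 + i))))) := by
    intro x _
    rw [smul_smul, ← pow_add, show i + (x + 1) = i + 1 + x by omega, ds_succ,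
      EE_congr B _ i (u := ds (i + 1 + x) u) (v := u)]
    · congr 4
      funext l
      simp only [ds]
      by_cases h1 : l < x
      · rw [if_pos h1, if_pos (by omega)]
      · by_cases h2 : l = x
        · subst h2
          rw [if_neg h1, if_pos rfl, if_neg (by omega), if_pos (by omega)]
          congr 2 <;> omega
        · rw [if_neg h1, if_neg h2, if_neg (by omega), if_neg (by omega)]
          congr 1; omega
    · intro l hl
      simp only [ds]
      rw [if_pos (by omega)]
  have e3 : EE B (bact B q) i (lst B (i + q) u)
          (bgenC k B q (scons 1 (fun l => lst B (i + q) u (l + 1 + i))))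
      = EE B (bact B q) i u (bgenC k B q (lst B q (scons 1 (fun l => u (l + 1 + i))))) := by
    cases q with
    | zero =>
      rw [add_zero, EE_lst, lst_zero, one_mul, bact_gen, mul_one, zero_add, add_comm 1 i]
      congr 1
      refine bgen_congr B ?_
      rintro (_ | l) hl
      · rfl
      · omega
    | succ q =>
      rw [lst_succ, EE_congr B _ i (u := lst B (i + (q + 1)) u) (v := u)]
      · congr 3
        funext l
        simp only [lst]
        by_cases h : l = q
        · rw [if_pos h, if_pos (by omega), show q + 1 + i = i + (q + 1) by omega,
            show q + 1 + 1 + i = i + (q + 1) + 1 by omega]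
        · rw [if_neg h, if_neg (by omega)]
      · intro l hl
        simp only [lst]
        rw [if_neg (by omega)]
  have e4 : bgenC k B q (ds 0 (scons 1 (fun l => u (l + 1 + i))))
      = bact B q (u (i + 1)) (bgenC k B q (scons 1 (fun l => u (l + 1 + i + 1)))) := by
    rw [ds_zero, one_mul, bact_gen, mul_one, zero_add, add_comm 1 i]
    congr 2
    funext l
    simp only [shf]
    congr 1; omega
  rw [Finset.sum_congr rfl e1, Finset.sum_congr rfl e2, e3, e4, ← Finset.smul_sum]
  simp only [smul_add, smul_smul, ← pow_add]
  rw [show i + 1 + q = i + (q + 1) by omega, show i + 0 = i from rfl, pow_succ]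
  simp only [mul_neg, mul_one, neg_smul]
  abel

lemma if_scons (y : U) (T : ℕ → U) :
    (fun l => if l = 0 then y else T l) = scons y (fun l => T (l + 1)) := by
  funext l
  cases l with
  | zero => rfl
  | succ l => rfl

lemma mkT_bal (i j : ℕ) (a : A) (x : BarC k B i) (y : BarC k B j) :
    mkT k B i j (bact B i (B.tgt a) x) y = mkT k B i j x (bact B j (B.src a) y) := by
  let Q : BarC k B i →ₗ[k] BarC k B j →ₗ[k] BarT k B i j :=
    (TensorProduct.mk k (BarC k B i) (BarC k B j)).compr₂ (barTRel k B i j).mkQ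
  have h : Q ∘ₗ bact B i (B.tgt a) = Q.compl₂ (bact B j (B.src a)) := by
    refine bar_ext B fun v => bar_ext B fun w => ?_
    refine (Submodule.Quotient.eq _).2 (Submodule.subset_span ⟨a, v, w, ?_⟩)
    rw [if_scons, if_scons, ← bact_gen, ← bact_gen]
    have hv : scons (v 0) (fun l => v (l + 1)) = v := scons_shf v
    have hw : scons (w 0) (fun l => w (l + 1)) = w := scons_shf w
    rw [hv, hw]
    rfl
  exact LinearMap.congr_fun (LinearMap.congr_fun h x) y

/-- comparison with the frozen tensor product -/
def toT (i j : ℕ) : TT B (bact B i) (bact B j) →ₗ[k] BarT k B i j :=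
  tlift B (bact B i) (bact B j) (barTRel k B i j).mkQ (fun a m n => mkT_bal B i j a m n)

lemma toT_tmul (i j : ℕ) (x : BarC k B i) (y : BarC k B j) :
    toT B i j (tq B (bact B i) (bact B j) (x ⊗ₜ[k] y)) = mkT k B i j x y := rfl

lemma sum_toT (m i j : ℕ) (G : (ℕ → U) → BarC k B i) (u T : ℕ → U) :
    (∑ e : (∀ l : Fin m, Fin ((B.comul (u l.val)).length)),
      mkT k B i j (G (swFst k B u e))
        (bgenC k B j (fun l => if l = 0 then swSndProd k B u e else T l)))
    = toT B i j (SS B (bact B i) (bact B j) m G u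
        (bgenC k B j (scons 1 (fun l => T (l + 1))))) := by
  unfold SS
  rw [map_sw, map_sw]
  simp only [toT_tmul, bact_gen, mul_one, if_scons]
  exact sum_sw B m u (fun v y => mkT k B i j (G v) (bgenC k B j (scons y (fun l => T (l + 1)))))

lemma mk3_bal1 (a b c : ℕ) (s : A) (x : BarC k B a) (y : BarC k B b) (z : BarC k B c) :
    mk3 k B a b c (bact B a (B.tgt s) x) y z = mk3 k B a b c x (bact B b (B.src s) y) z := by
  let Q0 : BarC k B a →ₗ[k] (BarC k B b ⊗[k] BarC k B c) →ₗ[k] BarT3 k B a b c :=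
    (TensorProduct.mk k (BarC k B a) (BarC k B b ⊗[k] BarC k B c)).compr₂ (barT3Rel k B a b c).mkQ
  have h : Q0 ∘ₗ bact B a (B.tgt s)
      = Q0.compl₂ (TensorProduct.map (bact B b (B.src s)) LinearMap.id) := by
    refine bar_ext B fun v => TensorProduct.ext ?_
    refine bar_ext B fun w => bar_ext B fun x => ?_
    refine (Submodule.Quotient.eq _).2 (Submodule.subset_span (Or.inl ⟨s, v, w, x, ?_⟩))
    rw [if_scons, if_scons, ← bact_gen, ← bact_gen]
    have hv : scons (v 0) (fun l => v (l + 1)) = v := scons_shf v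
    have hw : scons (w 0) (fun l => w (l + 1)) = w := scons_shf w
    rw [hv, hw]
    rfl
  exact LinearMap.congr_fun (LinearMap.congr_fun h x) (y ⊗ₜ[k] z)

lemma mk3_bal2 (a b c : ℕ) (s : A) (x : BarC k B a) (y : BarC k B b) (z : BarC k B c) :
    mk3 k B a b c x (bact B b (B.tgt s) y) z = mk3 k B a b c x y (bact B c (B.src s) z) := by
  let Q0 : BarC k B a →ₗ[k] (BarC k B b ⊗[k] BarC k B c) →ₗ[k] BarT3 k B a b c :=
    (TensorProduct.mk k (BarC k B a) (BarC k B b ⊗[k] BarC k B c)).compr₂ (barT3Rel k B a b c).mkQ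
  have h : Q0.compl₂ (TensorProduct.map (bact B b (B.tgt s)) LinearMap.id)
      = Q0.compl₂ (TensorProduct.map LinearMap.id (bact B c (B.src s))) := by
    refine bar_ext B fun v => TensorProduct.ext ?_
    refine bar_ext B fun w => bar_ext B fun x => ?_
    refine (Submodule.Quotient.eq _).2 (Submodule.subset_span (Or.inr ⟨s, v, w, x, ?_⟩))
    rw [if_scons, if_scons, ← bact_gen, ← bact_gen]
    have hv : scons (x 0) (fun l => x (l + 1)) = x := scons_shf x
    have hw : scons (w 0) (fun l => w (l + 1)) = w := scons_shf w
    rw [hv, hw]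
    rfl
  exact LinearMap.congr_fun (LinearMap.congr_fun h x) (y ⊗ₜ[k] z)

/-- auxiliary for `to3` -/
def to3aux (a b c : ℕ) : TT B (bact B b) (bact B c) →ₗ[k] BarC k B a →ₗ[k] BarT3 k B a b c :=
  tlift B (bact B b) (bact B c)
    ((TensorProduct.mk k (BarC k B a) (BarC k B b ⊗[k] BarC k B c)).compr₂
      (barT3Rel k B a b c).mkQ).flip
    (fun s y z => LinearMap.ext fun x => mk3_bal2 B a b c s x y z)

lemma to3aux_tmul (a b c : ℕ) (x : BarC k B a) (y : BarC k B b) (z : BarC k B c) :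
    to3aux B a b c (tq B (bact B b) (bact B c) (y ⊗ₜ[k] z)) x = mk3 k B a b c x y z := rfl

/-- comparison with the frozen triple tensor product -/
def to3 (a b c : ℕ) : TT B (bact B a) (dact B (bact B b) (bact B c)) →ₗ[k] BarT3 k B a b c :=
  tlift B (bact B a) (dact B (bact B b) (bact B c))
    (TensorProduct.lift (to3aux B a b c).flip) (by
      intro s x w
      simp only [TensorProduct.lift.tmul, LinearMap.flip_apply]
      have : (to3aux B a b c).flip (bact B a (B.tgt s) x)
          = (to3aux B a b c).flip x ∘ₗ dact B (bact B b) (bact B c) (B.src s) := by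
        refine tt_ext B _ _ fun y z => ?_
        rw [LinearMap.comp_apply, dact_src, LinearMap.flip_apply, LinearMap.flip_apply,
          to3aux_tmul, to3aux_tmul, mk3_bal1]
      exact LinearMap.congr_fun this w)

lemma to3_tmul (a b c : ℕ) (x : BarC k B a) (y : BarC k B b) (z : BarC k B c) :
    to3 B a b c (tq B (bact B a) (dact B (bact B b) (bact B c))
      (x ⊗ₜ[k] tq B (bact B b) (bact B c) (y ⊗ₜ[k] z))) = mk3 k B a b c x y z := by
  unfold to3
  rw [tlift_tq, TensorProduct.lift.tmul, LinearMap.flip_apply, to3aux_tmul]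

lemma to3_tq3 (a b c : ℕ) (x : BarC k B a) (y : BarC k B b) (z : BarC k B c) :
    to3 B a b c (tq3 B (bact B a) (bact B b) (bact B c) (x ⊗ₜ[k] (y ⊗ₜ[k] z)))
      = mk3 k B a b c x y z := by
  rw [tq3_tmul, to3_tmul]

lemma coassoc_left (a b c : ℕ) (u : ℕ → U) :
    (∑ e : (∀ l : Fin (a + b + 1), Fin ((B.comul (u l.val)).length)),
        ∑ f : (∀ l : Fin (a + 1), Fin ((B.comul (swFst k B u e l.val)).length)),
          mk3 k B a b c
            (bgenC k B a (swFst k B (swFst k B u e) f))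
            (bgenC k B b (fun l => if l = 0 then swSndProd k B (swFst k B u e) f
                else swFst k B u e (l + a)))
            (bgenC k B c (fun l => if l = 0 then swSndProd k B u e else u (l + a + b))))
    = to3 B a b c (EE B (dact B (bact B b) (bact B c)) a u (XX B (bact B c) b
        (fun r => u (r + 1 + a)) (bgenC k B c (scons 1 (fun l => u (l + 1 + a + b)))))) := by
  rw [← tq3_LL]
  unfold LL
  simp only [map_sw, to3_tq3, bact_gen, mul_one]
  rw [← sum_sw]
  refine Finset.sum_congr rfl fun e _ => ?_
  rw [← sum_sw]
  refine Finset.sum_congr rfl fun f _ => ?_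
  rw [if_scons, if_scons _ (fun l => u (l + a + b))]

lemma coassoc_right (a b c : ℕ) (u : ℕ → U) :
    (∑ e' : (∀ l : Fin (a + 1), Fin ((B.comul (u l.val)).length)),
        ∑ f' : (∀ l : Fin (b + 1),
            Fin ((B.comul ((fun r => if r = 0 then swSndProd k B u e' else u (r + a))
              l.val)).length)),
          mk3 k B a b c
            (bgenC k B a (swFst k B u e'))
            (bgenC k B b
              (swFst k B (fun r => if r = 0 then swSndProd k B u e' else u (r + a)) f'))
            (bgenC k B c (fun l => if l = 0 then
                swSndProd k B (fun r => if r = 0 then swSndProd k B u e' else u (r + a)) f'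
              else u (l + b + a))))
    = to3 B a b c (EE B (dact B (bact B b) (bact B c)) a u (XX B (bact B c) b
        (fun r => u (r + 1 + a)) (bgenC k B c (scons 1 (fun l => u (l + 1 + a + b)))))) := by
  unfold EE SS
  rw [map_sw, map_sw, ← sum_sw]
  refine Finset.sum_congr rfl fun e _ => ?_
  have h : dact B (bact B b) (bact B c) (swSndProd k B u e) (XX B (bact B c) b
        (fun r => u (r + 1 + a)) (bgenC k B c (scons 1 (fun l => u (l + 1 + a + b)))))
      = EE B (bact B c) b (fun r => if r = 0 then swSndProd k B u e else u (r + a))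
        (bgenC k B c (scons 1 (fun l => u (l + 1 + a + b)))) := by
    rw [if_scons _ (fun r => u (r + a)), EE_eq]
    rfl
  rw [h]
  generalize (fun r => if r = 0 then swSndProd k B u e else u (r + a)) = w
  unfold EE SS
  have h2 := map_sw B (to3 B a b c ∘ₗ tq B (bact B a) (dact B (bact B b) (bact B c)) ∘ₗ
    TensorProduct.mk k _ _ (bgenC k B a (swFst k B u e)) ∘ₗ tq B (bact B b) (bact B c)) (b + 1) w
    (fun v y => bgenC k B b v ⊗ₜ[k]
      bact B c y (bgenC k B c (scons 1 (fun l => u (l + 1 + a + b)))))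
  refine Eq.trans ?_ h2.symm
  rw [← sum_sw]
  refine Finset.sum_congr rfl fun f _ => ?_
  simp only [LinearMap.comp_apply, TensorProduct.mk_apply, to3_tmul, bact_gen, mul_one]
  rw [if_scons _ (fun l => u (l + b + a))]
  congr 3
  funext l
  congr 1
  omega

lemma bar_sum {m : ℕ} {X : Type*} (l : List X) (f : X → U) (v : ℕ → U) :
    (l.map fun x => bgenC k B m (scons (f x) v)).sum = bgenC k B m (scons (l.map f).sum v) := by
  have h := map_list_sum' ((bact B m).toLinearMap.flip (bgenC k B m (scons 1 v))) l f
  simp only [LinearMap.flip_apply, AlgHom.toLinearMap_apply, bact_gen, mul_one] at h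
  exact h.symm

lemma counit_left (n : ℕ) (u : ℕ → U) :
      (∑ c : Fin ((B.comul (u 0)).length),
        bgenC k B n (fun l => if l = 0 then
            B.src (B.counit ((B.comul (u 0)).get c).1) * ((B.comul (u 0)).get c).2
          else u l))
      = bgenC k B n u := by
  simp only [if_scons]
  rw [sum_get (B.comul (u 0)) (fun p => bgenC k B n (scons (B.src (B.counit p.1) * p.2)
    (fun l => u (l + 1)))), bar_sum B (B.comul (u 0)) (fun p => B.src (B.counit p.1) * p.2),
    B.comul_counit_left]
  exact congrArg _ (scons_shf u)

lemma counit_right (n : ℕ) (u : ℕ → U) :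
      (∑ e : (∀ l : Fin (n + 1), Fin ((B.comul (u l.val)).length)),
        bgenC k B n (fun l => if l = 0 then
            B.tgt (B.counit (swSndProd k B u e)) * swFst k B u e 0
          else swFst k B u e l))
      = bgenC k B n u := by
  rw [← theta_EE B n u]
  unfold EE SS
  rw [map_sw, map_sw, ← sum_sw]
  refine Finset.sum_congr rfl fun e _ => ?_
  rw [theta_tmul, if_scons, ← bact_gen]
  have : scons (swFst k B u e 0) (fun l => swFst k B u e (l + 1)) = swFst k B u e := scons_shf _
  rw [this]
  simp

lemma bbar_head (O : BarOps k B) (q : ℕ) (y : U) (T : ℕ → U) :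
    O.bbar q (bgenC k B (q + 1) (scons y T))
      = bact B q y (O.bbar q (bgenC k B (q + 1) (scons 1 T))) := by
  have h1 := O.bbar_gen q (scons y T)
  have h2 := O.bbar_gen q (scons 1 T)
  rw [h1, h2, map_add, map_sum]
  congr 1
  · refine Finset.sum_congr rfl fun s _ => ?_
    rw [map_zsmul]
    congr 1
    exact bgen_ds B q s y T
  · rw [map_zsmul]
    congr 1
    exact bgen_lst B q q y T

lemma compP_EE (O : BarOps k B) (n i : ℕ) (hi : i ≤ n) (u : ℕ → U) :
    O.compP n i (bgenC k B n u) = toT B i (n - i)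
      (EE B (bact B (n - i)) i u (bgenC k B (n - i) (scons 1 (fun l => u (l + 1 + i))))) := by
  have h := sum_toT B (i + 1) i (n - i) (bgenC k B i) u (fun l => u (l + i))
  exact (O.compP_gen n i hi u).trans h

lemma bar_leibniz (O : BarOps k B) (n i : ℕ) (hi : i ≤ n) (u : ℕ → U) :
      O.compP n i (O.bbar n (bgenC k B (n + 1) u))
        = (∑ j : (∀ l : Fin (i + 2), Fin ((B.comul (u l.val)).length)),
            mkT k B i (n - i) (O.bbar i (bgenC k B (i + 1) (swFst k B u j)))
              (bgenC k B (n - i)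
                (fun l => if l = 0 then swSndProd k B u j else u (l + i + 1))))
          + ((-1 : ℤ) ^ i) •
            (∑ j : (∀ l : Fin (i + 1), Fin ((B.comul (u l.val)).length)),
              mkT k B i (n - i) (bgenC k B i (swFst k B u j))
                (O.bbar (n - i)
                  (bgenC k B (n - i + 1)
                    (fun l => if l = 0 then swSndProd k B u j else u (l + i))))) := by
  have r1 := sum_toT B (i + 2) i (n - i) (fun v => O.bbar i (bgenC k B (i + 1) v)) u
    (fun l => u (l + i + 1))
  have r2 : (∑ j : (∀ l : Fin (i + 1), Fin ((B.comul (u l.val)).length)),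
              mkT k B i (n - i) (bgenC k B i (swFst k B u j))
                (O.bbar (n - i)
                  (bgenC k B (n - i + 1)
                    (fun l => if l = 0 then swSndProd k B u j else u (l + i)))))
      = toT B i (n - i) (EE B (bact B (n - i)) i u
          (O.bbar (n - i) (bgenC k B (n - i + 1) (scons 1 (fun l => u (l + 1 + i)))))) := by
    unfold EE SS
    rw [map_sw, map_sw, ← sum_sw]
    refine Finset.sum_congr rfl fun e _ => ?_
    rw [if_scons _ (fun l => u (l + i)), bbar_head, toT_tmul]
  rw [r1, r2]
  have f1 : (fun v => O.bbar i (bgenC k B (i + 1) v))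
      = (∑ s ∈ Finset.range (i + 1), ((-1 : ℤ) ^ s) • (fun v => bgenC k B i (ds s v)))
        + ((-1 : ℤ) ^ (i + 1)) • (fun v => bgenC k B i (lst B i v)) := by
    funext v
    rw [Pi.add_apply, Finset.sum_apply]
    exact O.bbar_gen i v
  have f2 : O.bbar (n - i) (bgenC k B (n - i + 1) (scons 1 (fun l => u (l + 1 + i))))
      = (∑ s ∈ Finset.range (n - i + 1), ((-1 : ℤ) ^ s) •
          bgenC k B (n - i) (ds s (scons 1 (fun l => u (l + 1 + i)))))
        + ((-1 : ℤ) ^ (n - i + 1)) •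
          bgenC k B (n - i) (lst B (n - i) (scons 1 (fun l => u (l + 1 + i)))) :=
    O.bbar_gen (n - i) _
  have f3 : O.bbar n (bgenC k B (n + 1) u)
      = (∑ s ∈ Finset.range (n + 1), ((-1 : ℤ) ^ s) • bgenC k B n (ds s u))
        + ((-1 : ℤ) ^ (n + 1)) • bgenC k B n (lst B n u) :=
    O.bbar_gen n u
  rw [f1, f2, f3, ← SSh_apply]
  unfold EE
  rw [← SSn_apply]
  simp only [map_add, map_sum, map_zsmul]
  simp only [SSn_apply, SSh_apply, compP_EE B O n i hi]
  have key := congrArg (toT B i (n - i)) (bar_key B i (n - i) u)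
  rw [show i + (n - i) = n by omega] at key
  simp only [map_add, map_sum, map_zsmul] at key
  exact key

end BarHelpers

/-- For a left bialgebroid `U` over `A`, the comultiplication `Δ^P` on the bar resolution
`P` is coassociative and `(P, b', Δ^P, ε^P)` is a differential graded coalgebra: the
counit properties hold and `Δ^P b' = (b' ⊗ id + id ⊗ b') Δ^P` with Koszul signs. -/
theorem bar_resolution_dg_coalgebra
    (k : Type u) [CommRing k] (A U : Type u) [Ring A] [Algebra k A] [Ring U] [Algebra k U]
    (B : LeftBialgebroid k A U) (O : BarOps k B) :
    (∀ (a b c : ℕ) (u : ℕ → U),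
      (∑ e : (∀ l : Fin (a + b + 1), Fin ((B.comul (u l.val)).length)),
        ∑ f : (∀ l : Fin (a + 1), Fin ((B.comul (swFst k B u e l.val)).length)),
          mk3 k B a b c
            (bgenC k B a (swFst k B (swFst k B u e) f))
            (bgenC k B b (fun l => if l = 0 then swSndProd k B (swFst k B u e) f
                else swFst k B u e (l + a)))
            (bgenC k B c (fun l => if l = 0 then swSndProd k B u e else u (l + a + b))))
      = ∑ e' : (∀ l : Fin (a + 1), Fin ((B.comul (u l.val)).length)),
        ∑ f' : (∀ l : Fin (b + 1),
            Fin ((B.comul ((fun r => if r = 0 then swSndProd k B u e' else u (r + a))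
              l.val)).length)),
          mk3 k B a b c
            (bgenC k B a (swFst k B u e'))
            (bgenC k B b
              (swFst k B (fun r => if r = 0 then swSndProd k B u e' else u (r + a)) f'))
            (bgenC k B c (fun l => if l = 0 then
                swSndProd k B (fun r => if r = 0 then swSndProd k B u e' else u (r + a)) f'
              else u (l + b + a)))) ∧
    (∀ (n : ℕ) (u : ℕ → U),
      (∑ c : Fin ((B.comul (u 0)).length),
        bgenC k B n (fun l => if l = 0 then
            B.src (B.counit ((B.comul (u 0)).get c).1) * ((B.comul (u 0)).get c).2
          else u l))
      = bgenC k B n u) ∧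
    (∀ (n : ℕ) (u : ℕ → U),
      (∑ e : (∀ l : Fin (n + 1), Fin ((B.comul (u l.val)).length)),
        bgenC k B n (fun l => if l = 0 then
            B.tgt (B.counit (swSndProd k B u e)) * swFst k B u e 0
          else swFst k B u e l))
      = bgenC k B n u) ∧
    (∀ (n i : ℕ), i ≤ n → ∀ u : ℕ → U,
      O.compP n i (O.bbar n (bgenC k B (n + 1) u))
        = (∑ j : (∀ l : Fin (i + 2), Fin ((B.comul (u l.val)).length)),
            mkT k B i (n - i) (O.bbar i (bgenC k B (i + 1) (swFst k B u j)))
              (bgenC k B (n - i)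
                (fun l => if l = 0 then swSndProd k B u j else u (l + i + 1))))
          + ((-1 : ℤ) ^ i) •
            (∑ j : (∀ l : Fin (i + 1), Fin ((B.comul (u l.val)).length)),
              mkT k B i (n - i) (bgenC k B i (swFst k B u j))
                (O.bbar (n - i)
                  (bgenC k B (n - i + 1)
                    (fun l => if l = 0 then swSndProd k B u j else u (l + i)))))) := by
  exact ⟨fun a b c u => (coassoc_left B a b c u).trans (coassoc_right B a b c u).symm,
    fun n u => counit_left B n u, fun n u => counit_right B n u,
    fun n i hi u => bar_leibniz B O n i hi u⟩

end Statement5
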